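/- arXiv:1701.03884 — 5 statements merged into one kernel-verified Lean document; each statement's English description precedes it below -/
import Mathlib

section
/- Let p be a positive integer and let f be analytic in the unit disk 𝔻 = {z ∈ ℂ : |z| < 1} with |f(z)| ≤ 1 for all z ∈ 𝔻, and suppose f is p-symmetric, i.e. f(z) = ∑_{k≥0} a_{pk+1} z^{pk+1} for all z ∈ 𝔻. Let r_p ∈ (0,1) be the maximal root in (0,1) of the equation 8 r^{2p} + r^{2(p-1)} − 6 r^{p-1} + 1 = 0. Then for every r with 0 ≤ r ≤ r_p one has ∑_{k≥0} |a_{pk+1}| r^{pk+1} ≤ 1. -/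
open Complex in
lemma bohr_diff (b : ℕ → ℂ) (g : ℂ → ℂ)
    (hs : ∀ w : ℂ, ‖w‖ < 1 → HasSum (fun k : ℕ => b k * w ^ k) (g w)) :
    DifferentiableOn ℂ g (Metric.ball 0 1) := by
  intro w hw
  have hw1 : ‖w‖ < 1 := by simpa using hw
  obtain ⟨R, hR1, hR2⟩ := exists_between hw1
  have hR0 : 0 ≤ R := (norm_nonneg w).trans hR1.le
  have hsum : Summable (fun k : ℕ => ‖b k‖ * R ^ k) := by
    have := (hs (R : ℂ) (by simpa [abs_of_nonneg hR0] using hR2)).summable.norm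
    simpa [abs_of_nonneg hR0] using this
  have hd : DifferentiableOn ℂ (fun w : ℂ => ∑' k : ℕ, b k * w ^ k) (Metric.ball 0 R) := by
    refine differentiableOn_tsum_of_summable_norm hsum ?_ Metric.isOpen_ball ?_
    · intro i
      fun_prop
    · intro i z hz
      have : ‖z‖ ≤ R := le_of_lt (by simpa using hz)
      rw [norm_mul, norm_pow]
      gcongr
  have hat := hd.differentiableAt (Metric.isOpen_ball.mem_nhds (by simpa using hR1 : w ∈ Metric.ball (0:ℂ) R))
  refine (hat.congr_of_eventuallyEq ?_).differentiableWithinAt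
  filter_upwards [Metric.isOpen_ball.mem_nhds hw] with z hz
  exact (hs z (by simpa using hz)).tsum_eq.symm

lemma bohr_schwarz (g : ℂ → ℂ) (hd : DifferentiableOn ℂ g (Metric.ball 0 1))
    (hg : ∀ w : ℂ, ‖w‖ < 1 → ‖g w‖ < 1) (w : ℂ) (hw : ‖w‖ < 1) :
    ‖g w - g 0‖ ≤ ‖w‖ * ‖1 - (starRingEnd ℂ) (g 0) * g w‖ := by
  have h0 := hg 0 (by simp)
  have hne : ∀ z : ℂ, ‖z‖ < 1 → 1 - (starRingEnd ℂ) (g 0) * g z ≠ 0 := by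
    intro z hz h
    have h1 : (starRingEnd ℂ) (g 0) * g z = 1 := (sub_eq_zero.mp h).symm
    have h2 : ‖g 0‖ * ‖g z‖ = 1 := by simpa using congrArg norm h1
    have h3 := hg z hz
    nlinarith [norm_nonneg (g 0), norm_nonneg (g z)]
  have key : ‖(fun z => (g z - g 0) / (1 - (starRingEnd ℂ) (g 0) * g z)) w‖ ≤ ‖w‖ := by
    refine Complex.norm_le_norm_of_mapsTo_ball (R := 1)
      (f := fun z => (g z - g 0) / (1 - (starRingEnd ℂ) (g 0) * g z)) ?_ ?_ (by simp) hw
    · refine (hd.sub_const _).div ((hd.const_mul _).const_sub _) ?_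
      intro z hz
      exact hne z (by simpa using hz)
    · intro z hz
      have hz1 : ‖z‖ < 1 := by simpa using hz
      rw [mem_closedBall_zero_iff, norm_div, div_le_one (norm_pos_iff.mpr (hne z hz1))]
      have h3 := hg z hz1
      refine le_of_sq_le_sq ?_ (norm_nonneg _)
      have e : ‖1 - (starRingEnd ℂ) (g 0) * g z‖ ^ 2 - ‖g z - g 0‖ ^ 2
          = (1 - ‖g 0‖ ^ 2) * (1 - ‖g z‖ ^ 2) := by
        simp only [← Complex.normSq_eq_norm_sq, Complex.normSq_apply]
        simp
        ring
      have : 0 ≤ (1 - ‖g 0‖ ^ 2) * (1 - ‖g z‖ ^ 2) := by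
        apply mul_nonneg <;> nlinarith [norm_nonneg (g 0), norm_nonneg (g z)]
      linarith
  simp only [norm_div] at key
  rwa [div_le_iff₀ (norm_pos_iff.mpr (hne w hw))] at key

open MeasureTheory in
lemma bohr_key (b : ℕ → ℂ) (g : ℂ → ℂ)
    (hs : ∀ w : ℂ, ‖w‖ < 1 → HasSum (fun k : ℕ => b k * w ^ k) (g w))
    (hg : ∀ w : ℂ, ‖w‖ < 1 → ‖g w‖ < 1) (R : ℝ) (hR0 : 0 ≤ R) (hR1 : R < 1) (n : ℕ) :
    (1 - ‖b 0‖ ^ 2 * R ^ 2) * ∑ k ∈ Finset.range n, ‖b (k + 1)‖ ^ 2 * (R ^ 2) ^ (k + 1)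
      ≤ R ^ 2 * (1 - ‖b 0‖ ^ 2) ^ 2 := by
  have hg0 : g 0 = b 0 := by
    have h1 := hs 0 (by simp)
    have h2 := hasSum_single (f := fun k : ℕ => b k * (0:ℂ) ^ k) 0 (by intro k hk; simp [hk])
    simpa using h1.unique h2
  have hsum : Summable (fun k : ℕ => ‖b k‖ * R ^ k) := by
    have := (hs (R : ℂ) (by simpa [abs_of_nonneg hR0] using hR1)).summable.norm
    simpa [abs_of_nonneg hR0] using this
  let T : ℕ → C(UnitAddCircle, ℂ) := fun k => (b k * (R : ℂ) ^ k) • fourier (k : ℤ)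
  have hT : Summable T := by
    apply Summable.of_norm
    refine hsum.congr ?_
    intro k
    simp only [T, norm_smul, fourier_norm]
    simp [abs_of_nonneg hR0]
  let G : C(UnitAddCircle, ℂ) := ∑' k, T k
  have hfp : ∀ (k : ℕ) (x : UnitAddCircle), fourier (k : ℤ) x = (fourier 1 x : ℂ) ^ k := by
    intro k x
    induction k with
    | zero => simp
    | succ k ih => rw [Nat.cast_succ, fourier_add, ih, pow_succ]
  have hn1 : ∀ x : UnitAddCircle, ‖(fourier 1 x : ℂ)‖ = 1 := by
    intro x
    rw [fourier_one]
    exact Circle.norm_coe _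
  have hRn : ∀ x : UnitAddCircle, ‖(R : ℂ) * fourier 1 x‖ = R := by
    intro x
    rw [norm_mul, hn1]
    simp [abs_of_nonneg hR0]
  have hG : ∀ x, G x = g (R * fourier 1 x) := by
    intro x
    have h1 : HasSum (fun k => T k x) (G x) := ContinuousMap.hasSum_apply hT.hasSum x
    refine h1.unique ?_
    convert hs (R * fourier 1 x) (by rw [hRn]; exact hR1) using 2 with k
    simp only [T, ContinuousMap.smul_apply, smul_eq_mul, hfp, mul_pow]
    ring
  let L := ContinuousMap.toLp (E := ℂ) 2 (AddCircle.haarAddCircle (T := (1:ℝ))) ℂ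
  have hL : ∀ n : ℤ, L (fourier n) = fourierLp 2 n := fun n => rfl
  have hin : ∀ m : ℕ, inner ℂ (fourierLp (T := (1:ℝ)) 2 (m : ℤ)) (L G) = b m * (R : ℂ) ^ m := by
    intro m
    have h1 : HasSum (fun k => inner ℂ (fourierLp (T := (1:ℝ)) 2 (m : ℤ)) (L (T k)))
        (inner ℂ (fourierLp (T := (1:ℝ)) 2 (m : ℤ)) (L G)) :=
      ((innerSL ℂ (fourierLp (T := (1:ℝ)) 2 (m : ℤ))).hasSum (L.hasSum hT.hasSum))
    have h2 : ∀ k, inner ℂ (fourierLp (T := (1:ℝ)) 2 (m : ℤ)) (L (T k))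
        = if k = m then b m * (R : ℂ) ^ m else 0 := by
      intro k
      simp only [T, map_smul, hL, inner_smul_right]
      rw [orthonormal_iff_ite.mp orthonormal_fourier]
      by_cases h : k = m
      · subst h; simp
      · have : ¬ ((m : ℤ) = k) := by omega
        simp [h, this]
    simp_rw [h2] at h1
    exact h1.unique (hasSum_ite_eq m _)
  let U : C(UnitAddCircle, ℂ) := G - b 0 • fourier 0
  let V : C(UnitAddCircle, ℂ) := fourier 0 - (starRingEnd ℂ) (b 0) • G
  have hUV : ‖L U‖ ≤ R * ‖L V‖ := by
    apply Lp.norm_le_mul_norm_of_ae_le_mul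
    filter_upwards [ContinuousMap.coeFn_toLp (p := 2) (𝕜 := ℂ) (AddCircle.haarAddCircle (T := (1:ℝ))) U,
      ContinuousMap.coeFn_toLp (p := 2) (𝕜 := ℂ) (AddCircle.haarAddCircle (T := (1:ℝ))) V] with x h1 h2
    rw [h1, h2]
    have := bohr_schwarz g (bohr_diff b g hs) hg (R * fourier 1 x) (by rw [hRn]; exact hR1)
    rw [hRn, hg0] at this
    simpa [U, V, hG] using this
  set e0 := fourierLp (T := (1:ℝ)) 2 (0 : ℤ) with he0
  have hU : L U = L G - b 0 • e0 := by simp [U, he0, hL]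
  have hV : L V = (1 - (‖b 0‖ ^ 2 : ℝ) : ℂ) • e0 - (starRingEnd ℂ) (b 0) • L U := by
    have : (starRingEnd ℂ) (b 0) * b 0 = ((‖b 0‖ ^ 2 : ℝ) : ℂ) := by
      rw [mul_comm, Complex.mul_conj, Complex.normSq_eq_norm_sq]
    rw [hU, smul_sub, smul_smul, this, sub_smul]
    simp [V, he0, hL]
  have he0n : ‖e0‖ = 1 := (orthonormal_fourier (T := (1:ℝ))).1 0
  have hinU : ∀ m : ℕ, inner ℂ (fourierLp (T := (1:ℝ)) 2 (m : ℤ)) (L U)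
      = if m = 0 then 0 else b m * (R : ℂ) ^ m := by
    intro m
    rw [hU, inner_sub_right, inner_smul_right, hin, he0,
      orthonormal_iff_ite.mp orthonormal_fourier]
    by_cases h : m = 0
    · subst h; simp
    · simp [h]
  have hV2 : ‖L V‖ ^ 2 = (1 - ‖b 0‖ ^ 2) ^ 2 + ‖b 0‖ ^ 2 * ‖L U‖ ^ 2 := by
    have h0 : inner ℂ e0 (L U) = 0 := by simpa using hinU 0
    rw [hV, @norm_sub_sq ℂ, inner_smul_left, inner_smul_right, h0]
    rw [norm_smul, norm_smul, he0n, ← Complex.ofReal_one, ← Complex.ofReal_sub, Complex.norm_real]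
    simp [mul_pow]
  have hB := (orthonormal_fourier (T := (1:ℝ))).comp (fun k : ℕ => ((k + 1 : ℕ) : ℤ))
    (by intro x y h; simpa using h) |>.sum_inner_products_le (L U) (s := Finset.range n)
  have hB2 : ∑ k ∈ Finset.range n, ‖b (k + 1)‖ ^ 2 * (R ^ 2) ^ (k + 1) ≤ ‖L U‖ ^ 2 := by
    refine le_trans (le_of_eq (Finset.sum_congr rfl ?_)) hB
    intro k _
    have := hinU (k + 1)
    simp only [Function.comp_apply, this]
    simp [abs_of_nonneg hR0]
    ring
  have hb0 : ‖b 0‖ < 1 := by rw [← hg0]; exact hg 0 (by simp)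
  have h1 : ‖L U‖ ^ 2 ≤ R ^ 2 * ‖L V‖ ^ 2 := by
    rw [← mul_pow]; gcongr
  rw [hV2] at h1
  have h2 : 0 ≤ 1 - ‖b 0‖ ^ 2 * R ^ 2 := by
    have : ‖b 0‖ * R ≤ 1 := by nlinarith [norm_nonneg (b 0)]
    nlinarith [mul_nonneg (norm_nonneg (b 0)) hR0]
  nlinarith [mul_le_mul_of_nonneg_left hB2 h2]

lemma bohr_key2 (b : ℕ → ℂ) (g : ℂ → ℂ)
    (hs : ∀ w : ℂ, ‖w‖ < 1 → HasSum (fun k : ℕ => b k * w ^ k) (g w))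
    (hg : ∀ w : ℂ, ‖w‖ < 1 → ‖g w‖ ≤ 1) (s : ℝ) (hs0 : 0 ≤ s) (hs1 : s ≤ 1) (n : ℕ) :
    (1 - ‖b 0‖ ^ 2 * s) * ∑ k ∈ Finset.range n, ‖b (k + 1)‖ ^ 2 * s ^ (k + 1)
      ≤ s * (1 - ‖b 0‖ ^ 2) ^ 2 := by
  let S : Set ℝ := {t | (1 - (t * ‖b 0‖) ^ 2 * (t ^ 2 * s)) *
      ∑ k ∈ Finset.range n, (t * ‖b (k + 1)‖) ^ 2 * (t ^ 2 * s) ^ (k + 1)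
      ≤ (t ^ 2 * s) * (1 - (t * ‖b 0‖) ^ 2) ^ 2}
  have hS : IsClosed S := isClosed_le (by fun_prop) (by fun_prop)
  have hsub : Set.Ioo (0:ℝ) 1 ⊆ S := by
    rintro t ⟨ht0, ht1⟩
    have hR : t * √s < 1 := by
      have : √s ≤ 1 := by rw [Real.sqrt_le_left (by norm_num)]; simpa using hs1
      nlinarith [Real.sqrt_nonneg s]
    have := bohr_key (fun k => t * b k) (fun w => t * g w)
      (fun w hw => by simpa [mul_assoc] using (hs w hw).mul_left (t : ℂ))
      (fun w hw => by
        have := hg w hw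
        rw [norm_mul, Complex.norm_real, Real.norm_of_nonneg ht0.le]
        nlinarith) (t * √s) (by positivity) hR n
    simpa [S, mul_pow _ (√s), Real.sq_sqrt hs0, abs_of_pos ht0] using this
  have h1 : (1:ℝ) ∈ S := by
    have h := hS.closure_subset_iff.mpr hsub
    rw [closure_Ioo (by norm_num)] at h
    exact h (by simp)
  simpa [S] using h1

lemma bohr_geom (q : ℝ) (h0 : 0 ≤ q) (h1 : q < 1) (n : ℕ) :
    (1 - q) * ∑ k ∈ Finset.range n, q ^ (k + 1) ≤ q := by
  have : (1 - q) * ∑ k ∈ Finset.range n, q ^ (k + 1) = q * (1 - q ^ n) := by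
    induction n with
    | zero => simp
    | succ n ih => rw [Finset.sum_range_succ, mul_add, ih]; ring
  rw [this]
  nlinarith [mul_nonneg h0 (pow_nonneg h0 n)]

lemma bohr_main (b : ℕ → ℂ) (g : ℂ → ℂ)
    (hs : ∀ w : ℂ, ‖w‖ < 1 → HasSum (fun k : ℕ => b k * w ^ k) (g w))
    (hg : ∀ w : ℂ, ‖w‖ < 1 → ‖g w‖ ≤ 1) (r ρ : ℝ) (hρ0 : 0 < ρ) (hρr : ρ ≤ r) (hr1 : r < 1)
    (hroot : 8 * r ^ 2 * ρ ^ 2 + ρ ^ 2 - 6 * r * ρ + r ^ 2 = 0) (n : ℕ) :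
    r * (‖b 0‖ + ∑ k ∈ Finset.range n, ‖b (k + 1)‖ * ρ ^ (k + 1)) ≤ 1 := by
  have hr0 : 0 < r := hρ0.trans_le hρr
  have hρ1 : ρ < 1 := hρr.trans_lt hr1
  have hg0 : g 0 = b 0 := by
    have h1 := hs 0 (by simp)
    have h2 := hasSum_single (f := fun k : ℕ => b k * (0:ℂ) ^ k) 0 (by intro k hk; simp [hk])
    simpa using h1.unique h2
  have ha1 : ‖b 0‖ ≤ 1 := by rw [← hg0]; exact hg 0 (by simp)
  have ha0 := norm_nonneg (b 0)
  have hkey := bohr_key2 b g hs hg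
  set a := ‖b 0‖
  set A := ∑ k ∈ Finset.range n, ‖b (k + 1)‖ * ρ ^ (k + 1) with hA
  have hA0 : 0 ≤ A := Finset.sum_nonneg fun k _ => by positivity
  -- the quadratic is nonnegative
  have hquad : ∀ x : ℝ, 0 ≤ 2 * r * ρ * x ^ 2 - (r + ρ) * x + 1 - r * ρ := by
    intro x
    have h : 0 ≤ (8 * r * ρ) * (2 * r * ρ * x ^ 2 - (r + ρ) * x + 1 - r * ρ) := by
      have : (8 * r * ρ) * (2 * r * ρ * x ^ 2 - (r + ρ) * x + 1 - r * ρ)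
        = (4 * r * ρ * x - (r + ρ)) ^ 2 := by linear_combination (-1) * hroot
      rw [this]; positivity
    exact nonneg_of_mul_nonneg_right h (by positivity)
  -- Cauchy-Schwarz
  have hCS : ∀ s : ℝ, 0 < s → A ^ 2 ≤ (∑ k ∈ Finset.range n, ‖b (k + 1)‖ ^ 2 * s ^ (k + 1)) *
      ∑ k ∈ Finset.range n, (ρ ^ 2 / s) ^ (k + 1) := by
    intro s hs0
    have h := Finset.sum_mul_sq_le_sq_mul_sq (Finset.range n)
      (fun k => ‖b (k + 1)‖ * (√s) ^ (k + 1)) (fun k => (ρ / √s) ^ (k + 1))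
    have e1 : ∀ k : ℕ, ‖b (k + 1)‖ * (√s) ^ (k + 1) * (ρ / √s) ^ (k + 1)
        = ‖b (k + 1)‖ * ρ ^ (k + 1) := by
      intro k
      rw [mul_assoc, ← mul_pow, mul_div_cancel₀ _ (Real.sqrt_pos.mpr hs0).ne']
    have e2 : ∀ k : ℕ, (‖b (k + 1)‖ * (√s) ^ (k + 1)) ^ 2 = ‖b (k + 1)‖ ^ 2 * s ^ (k + 1) := by
      intro k
      rw [mul_pow, pow_right_comm, Real.sq_sqrt hs0.le]
    have e3 : ∀ k : ℕ, ((ρ / √s) ^ (k + 1)) ^ 2 = (ρ ^ 2 / s) ^ (k + 1) := by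
      intro k
      rw [pow_right_comm, div_pow, Real.sq_sqrt hs0.le]
    simpa only [e1, e2, e3] using h
  rcases le_or_gt ρ a with hcase | hcase
  · have hapos : 0 < a := hρ0.trans_le hcase
    have hk := hkey (ρ / a) (by positivity) (by rw [div_le_one hapos]; exact hcase) n
    have hc := hCS (ρ / a) (by positivity)
    have q1 : ρ ^ 2 / (ρ / a) = a * ρ := by field_simp
    have q2 : a ^ 2 * (ρ / a) = a * ρ := by field_simp
    have haρ : a * ρ < 1 := by nlinarith
    have hgeo := bohr_geom (a * ρ) (by positivity) haρ n
    rw [q1] at hc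
    rw [q2] at hk
    set X := ∑ k ∈ Finset.range n, ‖b (k + 1)‖ ^ 2 * (ρ / a) ^ (k + 1)
    set Y := ∑ k ∈ Finset.range n, (a * ρ) ^ (k + 1)
    have hY0 : 0 ≤ Y := Finset.sum_nonneg fun k _ => by positivity
    have hd : 0 < 1 - a * ρ := by linarith
    have hAb : (1 - a * ρ) * A ≤ ρ * (1 - a ^ 2) := by
      have hnn : 0 ≤ 1 - a ^ 2 := by nlinarith
      refine le_of_sq_le_sq ?_ (by positivity)
      calc ((1 - a * ρ) * A) ^ 2 = (1 - a * ρ) ^ 2 * A ^ 2 := by ring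
        _ ≤ (1 - a * ρ) ^ 2 * (X * Y) := by gcongr
        _ = ((1 - a * ρ) * X) * ((1 - a * ρ) * Y) := by ring
        _ ≤ (ρ / a * (1 - a ^ 2) ^ 2) * (a * ρ) := by gcongr
        _ = (ρ * (1 - a ^ 2)) ^ 2 := by field_simp
    have hq := hquad a
    have : (1 - a * ρ) * (r * (a + A)) ≤ (1 - a * ρ) * 1 := by
      nlinarith [mul_le_mul_of_nonneg_left hAb hr0.le]
    exact le_of_mul_le_mul_left this hd
  · have hk := hkey 1 (by norm_num) le_rfl n
    have hc := hCS 1 (by norm_num)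
    have hgeo := bohr_geom (ρ ^ 2) (by positivity) (by nlinarith) n
    simp only [div_one, mul_one, one_mul] at hc hk
    set X := ∑ k ∈ Finset.range n, ‖b (k + 1)‖ ^ 2 * (1:ℝ) ^ (k + 1)
    set Y := ∑ k ∈ Finset.range n, (ρ ^ 2) ^ (k + 1)
    have hY0 : 0 ≤ Y := Finset.sum_nonneg fun k _ => by positivity
    have hd : 0 < 1 - a ^ 2 := by nlinarith
    have hX : X ≤ 1 - a ^ 2 := by
      refine le_of_mul_le_mul_left (hk.trans_eq ?_) hd
      ring
    have h2rho : 2 * r * ρ ≤ 1 := by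
      have h := hquad ρ
      have h' : 0 ≤ (1 - ρ ^ 2) * (1 - 2 * r * ρ) := by nlinarith
      have := nonneg_of_mul_nonneg_right h' (by nlinarith)
      linarith
    have hρ2 : 2 * ρ ^ 2 ≤ 1 := by nlinarith
    have hd2 : 0 < 1 - ρ ^ 2 := by nlinarith
    have hAb : A ≤ 2 * ρ - a := by
      refine le_of_sq_le_sq ?_ (by linarith)
      refine le_of_mul_le_mul_left ?_ hd2
      calc (1 - ρ ^ 2) * A ^ 2 ≤ (1 - ρ ^ 2) * (X * Y) := by gcongr
        _ = X * ((1 - ρ ^ 2) * Y) := by ring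
        _ ≤ (1 - a ^ 2) * ρ ^ 2 := by gcongr
        _ ≤ (1 - ρ ^ 2) * (2 * ρ - a) ^ 2 := by
          have h1 : 0 ≤ 2 * ρ * (ρ - a) * (1 - 2 * ρ ^ 2) :=
            mul_nonneg (mul_nonneg (by linarith) (by linarith)) (by linarith)
          nlinarith [sq_nonneg (ρ - a)]
    nlinarith [mul_le_mul_of_nonneg_left hAb hr0.le]


/-- Bohr inequality for `p`-symmetric bounded analytic functions in the unit disk:
if `f(z) = ∑_{k≥0} a_{pk+1} z^{pk+1}` with `|f| ≤ 1` on 𝔻 and `r_p` is the maximal root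
in `(0,1)` of `8 r^{2p} + r^{2(p-1)} - 6 r^{p-1} + 1 = 0`, then the majorant series of `f`
is at most `1` for all `0 ≤ r ≤ r_p`. -/
theorem bohr_p_symmetric (p : ℕ) (hp : 0 < p) (f : ℂ → ℂ) (a : ℕ → ℂ)
    (hf : ∀ z ∈ Metric.ball (0 : ℂ) 1, HasSum (fun k : ℕ => a k * z ^ (p * k + 1)) (f z))
    (hb : ∀ z ∈ Metric.ball (0 : ℂ) 1, ‖f z‖ ≤ 1)
    (rp : ℝ) (hrp : rp ∈ Set.Ioo (0 : ℝ) 1)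
    (hroot : 8 * rp ^ (2 * p) + rp ^ (2 * (p - 1)) - 6 * rp ^ (p - 1) + 1 = 0)
    (hmax : ∀ s ∈ Set.Ioo (0 : ℝ) 1,
      8 * s ^ (2 * p) + s ^ (2 * (p - 1)) - 6 * s ^ (p - 1) + 1 = 0 → s ≤ rp) :
    ∀ r : ℝ, 0 ≤ r → r ≤ rp → ∑' k : ℕ, ‖a k‖ * r ^ (p * k + 1) ≤ 1 := by
  obtain ⟨hr0, hr1⟩ := hrp
  have hex : ∀ w : ℂ, ∃ z : ℂ, z ^ p = w := fun w => IsAlgClosed.exists_pow_nat_eq w hp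
  have hlt : ∀ z w : ℂ, z ^ p = w → ‖w‖ < 1 → ‖z‖ < 1 := by
    intro z w h hw
    by_contra hcon
    push Not at hcon
    rw [← h, norm_pow] at hw
    exact absurd (one_le_pow₀ hcon (n := p)) (not_le.mpr hw)
  have hsum : ∀ w : ℂ, ‖w‖ < 1 → Summable (fun k : ℕ => a k * w ^ k) := by
    intro w hw
    by_cases hw0 : w = 0
    · subst hw0
      exact (hasSum_single (f := fun k : ℕ => a k * (0:ℂ) ^ k) 0
        (by intro k hk; simp [hk])).summable
    obtain ⟨z, hz⟩ := hex w
    have hz0 : z ≠ 0 := by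
      rintro rfl
      exact hw0 (by rw [← hz, zero_pow hp.ne'])
    have h := (hf z (by simpa using hlt z w hz hw)).summable.mul_right z⁻¹
    refine h.congr ?_
    intro k
    rw [pow_succ, pow_mul, hz]
    field_simp
  let g : ℂ → ℂ := fun w => ∑' k : ℕ, a k * w ^ k
  have hs : ∀ w : ℂ, ‖w‖ < 1 → HasSum (fun k : ℕ => a k * w ^ k) (g w) :=
    fun w hw => (hsum w hw).hasSum
  have hgd := bohr_diff a g hs
  have hfg : ∀ z : ℂ, ‖z‖ < 1 → f z = z * g (z ^ p) := by
    intro z hz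
    have hzp : ‖z ^ p‖ < 1 := by
      rw [norm_pow]; exact pow_lt_one₀ (norm_nonneg _) hz hp.ne'
    refine (hf z (by simpa using hz)).unique ?_
    refine ((hs _ hzp).mul_left z).congr_fun ?_
    intro k
    rw [pow_succ, pow_mul]; ring
  have hfd : DifferentiableOn ℂ f (Metric.ball 0 1) := by
    have : DifferentiableOn ℂ (fun z : ℂ => z * g (z ^ p)) (Metric.ball 0 1) := by
      refine differentiableOn_id.mul (hgd.comp (by fun_prop) ?_)
      intro z hz
      simp only [mem_ball_zero_iff, norm_pow] at hz ⊢
      exact pow_lt_one₀ (norm_nonneg _) hz hp.ne'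
    exact this.congr fun z hz => hfg z (by simpa using hz)
  have hgne : ∀ w : ℂ, ‖w‖ < 1 → w ≠ 0 → ‖g w‖ ≤ 1 := by
    intro w hw hw0
    obtain ⟨z, hz⟩ := hex w
    have hz0 : z ≠ 0 := by
      rintro rfl
      exact hw0 (by rw [← hz, zero_pow hp.ne'])
    have hz1 := hlt z w hz hw
    have h := Complex.norm_le_norm_of_mapsTo_ball (R := 1) hfd
      (fun y hy => by simpa using hb y hy) (by simpa using hfg 0 (by simp)) hz1
    rw [hfg z hz1, norm_mul, hz] at h
    exact le_of_mul_le_mul_left (by simpa using h) (norm_pos_iff.mpr hz0)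
  have hg : ∀ w : ℂ, ‖w‖ < 1 → ‖g w‖ ≤ 1 := by
    intro w hw
    by_cases hw0 : w = 0
    · subst hw0
      have hc : ContinuousAt g 0 :=
        (hgd.differentiableAt (Metric.ball_mem_nhds _ one_pos)).continuousAt
      have ht : Filter.Tendsto (fun w => ‖g w‖) (nhdsWithin 0 {0}ᶜ) (nhds ‖g 0‖) :=
        (hc.norm.tendsto).mono_left nhdsWithin_le_nhds
      refine le_of_tendsto ht ?_
      filter_upwards [self_mem_nhdsWithin,
        nhdsWithin_le_nhds (Metric.ball_mem_nhds (0:ℂ) one_pos)] with y hy hy1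
      exact hgne y (by simpa using hy1) hy
    · exact hgne w hw hw0
  have hρr : rp ^ p ≤ rp := by
    simpa using pow_le_pow_of_le_one hr0.le hr1.le hp
  have hroot' : 8 * rp ^ 2 * (rp ^ p) ^ 2 + (rp ^ p) ^ 2 - 6 * rp * rp ^ p + rp ^ 2 = 0 := by
    obtain ⟨m, rfl⟩ : ∃ m, p = m + 1 := ⟨p - 1, by omega⟩
    simp only [Nat.add_sub_cancel] at hroot
    have : rp ^ 2 * (8 * rp ^ (2 * (m + 1)) + rp ^ (2 * m) - 6 * rp ^ m + 1) = 0 := by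
      rw [hroot, mul_zero]
    rw [← this]
    ring
  have hmain := bohr_main a g hs hg rp (rp ^ p) (by positivity) hρr hr1 hroot'
  intro r h0 h1
  refine Real.tsum_le_of_sum_range_le (fun n => by positivity) ?_
  intro n
  calc ∑ k ∈ Finset.range n, ‖a k‖ * r ^ (p * k + 1)
      ≤ ∑ k ∈ Finset.range (n + 1), ‖a k‖ * r ^ (p * k + 1) :=
        Finset.sum_le_sum_of_subset_of_nonneg (Finset.range_mono (Nat.le_succ n))
          (fun k _ _ => by positivity)
    _ ≤ ∑ k ∈ Finset.range (n + 1), ‖a k‖ * rp ^ (p * k + 1) := by gcongr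
    _ = rp * (‖a 0‖ + ∑ k ∈ Finset.range n, ‖a (k + 1)‖ * (rp ^ p) ^ (k + 1)) := by
        rw [Finset.sum_range_succ', mul_add, Finset.mul_sum, add_comm]
        congr 1
        · simp [mul_comm]
        · refine Finset.sum_congr rfl fun k _ => ?_
          rw [pow_succ, pow_mul]; ring
    _ ≤ 1 := hmain n
end

section
/- If f is an odd analytic function in the unit disk 𝔻 with |f(z)| ≤ 1 for all z ∈ 𝔻, and f(z) = ∑_{k≥0} a_{2k+1} z^{2k+1} is its Taylor expansion, then ∑_{k≥0} |a_{2k+1}| r^{2k+1} ≤ 1 for all 0 ≤ r ≤ r_2, where r_2 ∈ (0,1) is the maximal root in (0,1) of the equation 8 r^4 + r^2 − 6 r + 1 = 0 (numerically r_2 = 0.789991…). -/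
theorem bo_le_of_sq_le_sq {x y : ℝ} (hy : 0 ≤ y) (h : x ^ 2 ≤ y ^ 2) : x ≤ y :=
  (le_abs_self x).trans (abs_le_of_sq_le_sq h hy)

theorem bo_alg (A B : ℂ) (hA : ‖A‖ ≤ 1) (hB : ‖B‖ ≤ 1) :
    ‖A - B‖ ^ 2 ≤ ‖1 - (starRingEnd ℂ) B * A‖ ^ 2 := by
  have hA' : ‖A‖ ^ 2 ≤ 1 := pow_le_one₀ (norm_nonneg _) hA
  have hB' : ‖B‖ ^ 2 ≤ 1 := pow_le_one₀ (norm_nonneg _) hB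
  simp only [← Complex.normSq_eq_norm_sq, Complex.normSq_apply] at *
  simp
  nlinarith [mul_nonneg (sub_nonneg.mpr hA') (sub_nonneg.mpr hB')]

theorem bo_parseval (b : ℕ → ℂ) (hb : Summable fun k => ‖b k‖) :
    ∃ u : C(AddCircle (1:ℝ), ℂ), (∀ t, HasSum (fun k => b k * (fourier 1 t) ^ k) (u t)) ∧
      HasSum (fun k => ‖b k‖ ^ 2)
        (‖ContinuousMap.toLp (E := ℂ) 2 AddCircle.haarAddCircle ℂ u‖ ^ 2) := by
  have hs : Summable fun k : ℕ => b k • (fourier (k : ℤ) : C(AddCircle (1:ℝ), ℂ)) := by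
    refine Summable.of_norm ?_
    simpa only [norm_smul, fourier_norm, mul_one] using hb
  obtain ⟨u, hu⟩ := hs
  refine ⟨u, ?_, ?_⟩
  · intro t
    have h := hu.mapL (ContinuousMap.evalCLM ℂ t)
    have e : (fun k : ℕ => ContinuousMap.evalCLM ℂ t (b k • (fourier (k : ℤ) : C(AddCircle (1:ℝ), ℂ))))
        = fun k => b k * (fourier 1 t) ^ k := by
      funext k
      simp [AddCircle.toCircle_nsmul]
    rw [e] at h
    simpa using h
  · have h := hu.mapL (ContinuousMap.toLp (E := ℂ) 2 (@AddCircle.haarAddCircle 1 _) ℂ)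
    have h2 : Filter.Tendsto _ _ _ := h
    have h3 := (h2.norm).pow 2
    refine Filter.Tendsto.congr ?_ h3
    intro s
    have ho : Orthonormal ℂ (fun k : ℕ => fourierLp (T := (1:ℝ)) 2 (k : ℤ)) :=
      orthonormal_fourier.comp _ Nat.cast_injective
    have := ho.inner_sum b b s
    rw [inner_self_eq_norm_sq_to_K] at this
    have h4 : ∀ i, (starRingEnd ℂ) (b i) * b i = ((‖b i‖ ^ 2 : ℝ) : ℂ) := by
      intro i
      rw [mul_comm, Complex.mul_conj, Complex.normSq_eq_norm_sq]
    simp only [h4] at this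
    rw [← Complex.ofReal_sum] at this
    have h5 := this
    have h6 : ‖∑ i ∈ s, b i • fourierLp (T := (1:ℝ)) 2 (i : ℤ)‖ ^ 2 = ∑ i ∈ s, ‖b i‖ ^ 2 := by
      exact Complex.ofReal_injective ((by push_cast; rfl : _ = _).trans h5)
    rw [← h6]
    simp [fourierLp]

theorem bo_parseval_le (b c : ℕ → ℂ) (hb : Summable fun k => ‖b k‖) (hc : Summable fun k => ‖c k‖)
    (h : ∀ u : ℂ, ‖u‖ = 1 → ‖∑' k, b k * u ^ k‖ ≤ ‖∑' k, c k * u ^ k‖) :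
    ∑' k, ‖b k‖ ^ 2 ≤ ∑' k, ‖c k‖ ^ 2 := by
  obtain ⟨u, hu, hu2⟩ := bo_parseval b hb
  obtain ⟨v, hv, hv2⟩ := bo_parseval c hc
  rw [hu2.tsum_eq, hv2.tsum_eq]
  refine pow_le_pow_left₀ (norm_nonneg _) ?_ 2
  refine MeasureTheory.Lp.norm_le_norm_of_ae_le ?_
  filter_upwards [ContinuousMap.coeFn_toLp (p := 2) (𝕜 := ℂ) AddCircle.haarAddCircle u,
    ContinuousMap.coeFn_toLp (p := 2) (𝕜 := ℂ) AddCircle.haarAddCircle v] with t h1 h2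
  rw [h1, h2]
  have := h (fourier 1 t) (Circle.norm_coe _)
  rwa [(hu t).tsum_eq, (hv t).tsum_eq] at this

theorem bo_pick (g : ℂ → ℂ) (hd : DifferentiableOn ℂ g (Metric.ball 0 1))
    (hg : ∀ z ∈ Metric.ball (0:ℂ) 1, ‖g z‖ ≤ 1) (z : ℂ) (hz : z ∈ Metric.ball (0:ℂ) 1) :
    ‖g z - g 0‖ ≤ ‖z‖ * ‖1 - (starRingEnd ℂ) (g 0) * g z‖ := by
  have h0 : (0:ℂ) ∈ Metric.ball (0:ℂ) 1 := by simp
  have key : ∀ t : ℝ, 0 < t → t < 1 →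
      ‖t * g z - t * g 0‖ ≤ ‖z‖ * ‖1 - (starRingEnd ℂ) (t * g 0) * (t * g z)‖ := by
    intro t ht0 ht1
    set G : ℂ → ℂ := fun w => t * g w with hG
    have hGn : ∀ w ∈ Metric.ball (0:ℂ) 1, ‖G w‖ < 1 := by
      intro w hw
      have := hg w hw
      simp only [hG, norm_mul, Complex.norm_real, Real.norm_eq_abs, abs_of_pos ht0]
      nlinarith
    have hne : ∀ w ∈ Metric.ball (0:ℂ) 1, 1 - (starRingEnd ℂ) (G 0) * G w ≠ 0 := by
      intro w hw h
      have h1 : (starRingEnd ℂ) (G 0) * G w = 1 := (sub_eq_zero.mp h).symm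
      have h2 : ‖G 0‖ * ‖G w‖ = 1 := by
        have := congrArg norm h1
        simpa only [norm_mul, RCLike.norm_conj, norm_one] using this
      nlinarith [hGn w hw, hGn 0 h0, norm_nonneg (G w), norm_nonneg (G 0)]
    have hGd : DifferentiableOn ℂ G (Metric.ball 0 1) := hd.const_mul _
    have hS := Complex.norm_le_norm_of_mapsTo_ball (R := 1) (z := z)
      (f := fun w => (G w - G 0) / (1 - (starRingEnd ℂ) (G 0) * G w)) ?_ ?_ (by simp) (by simpa using hz)
    · rw [norm_div, div_le_iff₀ (norm_pos_iff.mpr (hne z hz))] at hS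
      exact hS
    · exact (hGd.sub_const _).div ((hGd.const_mul _).const_sub 1) hne
    · intro w hw
      have hn := norm_pos_iff.mpr (hne w hw)
      simp only [mem_closedBall_zero_iff, norm_div]
      rw [div_le_one hn]
      refine bo_le_of_sq_le_sq (norm_nonneg _) ?_
      have hA := hGn w hw
      have hB := hGn 0 h0
      exact bo_alg _ _ hA.le hB.le
  have hc1 : Filter.Tendsto (fun t : ℝ => ‖(t:ℂ) * g z - t * g 0‖) (nhdsWithin 1 (Set.Iio 1))
      (nhds ‖((1:ℝ):ℂ) * g z - ((1:ℝ):ℂ) * g 0‖) :=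
    (Continuous.tendsto (by fun_prop) 1).mono_left nhdsWithin_le_nhds
  have hc2 : Filter.Tendsto (fun t : ℝ => ‖z‖ * ‖1 - (starRingEnd ℂ) ((t:ℂ) * g 0) * (t * g z)‖)
      (nhdsWithin 1 (Set.Iio 1))
      (nhds (‖z‖ * ‖1 - (starRingEnd ℂ) (((1:ℝ):ℂ) * g 0) * (((1:ℝ):ℂ) * g z)‖)) :=
    (Continuous.tendsto (by fun_prop) 1).mono_left nhdsWithin_le_nhds
  have hfin := le_of_tendsto_of_tendsto hc1 hc2 (by
    filter_upwards [Ioo_mem_nhdsLT (show (0:ℝ) < 1 by norm_num)] with t ht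
    exact key t ht.1 ht.2)
  simpa using hfin

theorem bo_coeff (a : ℕ → ℂ) (s : ℝ) (hs0 : 0 < s) (hs : Summable fun k => ‖a k‖ * s ^ k)
    (hp : ∀ z : ℂ, ‖z‖ = s → ‖(∑' k, a k * z ^ k) - a 0‖
      ≤ s * ‖1 - (starRingEnd ℂ) (a 0) * ∑' k, a k * z ^ k‖) (hs1 : s < 1)
    (ha0 : ‖a 0‖ ≤ 1) (n : ℕ) :
    (∑ k ∈ Finset.range n, ‖a (k + 1)‖ ^ 2 * (s ^ 2) ^ k) * (1 - ‖a 0‖ ^ 2 * s ^ 2)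
      ≤ (1 - ‖a 0‖ ^ 2) ^ 2 := by
  set q : ℕ → ℂ := fun k => a (k + 1) * (s : ℂ) ^ (k + 1) with hq
  set al : ℂ := ((1 - ‖a 0‖ ^ 2 : ℝ) : ℂ) with hal
  have hqn : ∀ k, ‖q k‖ = ‖a (k + 1)‖ * s ^ (k + 1) := by
    intro k; simp [hq, abs_of_pos hs0]
  have hqs : Summable fun k => ‖q k‖ := by
    simp only [hqn]
    exact (summable_nat_add_iff (f := fun k => ‖a k‖ * s ^ k) 1).mpr hs
  let b : ℕ → ℂ := fun k => Nat.casesOn k 0 q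
  let c : ℕ → ℂ := fun k => Nat.casesOn k (s * al) (fun j => -(s * (starRingEnd ℂ) (a 0)) * q j)
  have hb : Summable fun k => ‖b k‖ := (summable_nat_add_iff 1).mp hqs
  have hcs : Summable fun j => ‖-(s * (starRingEnd ℂ) (a 0)) * q j‖ := by
    simp only [norm_mul]
    exact hqs.mul_left _
  have hc : Summable fun k => ‖c k‖ := (summable_nat_add_iff 1).mp hcs
  have hu : ∀ u : ℂ, ‖u‖ = 1 → ∀ d : ℕ → ℂ, (Summable fun k => ‖d k‖) →
      Summable fun k => d k * u ^ k := by
    intro u hu d hd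
    refine Summable.of_norm ?_
    simpa [hu] using hd
  have main := bo_parseval_le b c hb hc (by
    intro u hu1
    have hz := hp (s * u) (by simp [hu1, abs_of_pos hs0])
    have hgs : Summable fun k => a k * ((s:ℂ) * u) ^ k := by
      refine Summable.of_norm ?_
      simpa [hu1, abs_of_pos hs0] using hs
    have e0 := hgs.tsum_eq_zero_add
    have e1 := (hu u hu1 b hb).tsum_eq_zero_add
    have e2 := (hu u hu1 c hc).tsum_eq_zero_add
    set T := ∑' k, q k * u ^ (k + 1) with hT
    have e0' : ∑' k, a k * ((s:ℂ) * u) ^ k = a 0 + T := by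
      rw [e0, hT]
      simp only [hq, pow_zero, mul_one]
      congr 1
      exact tsum_congr fun k => by rw [mul_pow]; ring
    have e1' : ∑' k, b k * u ^ k = T := by
      rw [e1]; simp [b, hT]
    have e2' : ∑' k, c k * u ^ k = s * (1 - (starRingEnd ℂ) (a 0) * (a 0 + T)) := by
      rw [e2]
      have : ∑' k, c (k + 1) * u ^ (k + 1) = -(s * (starRingEnd ℂ) (a 0)) * T := by
        rw [hT, ← tsum_mul_left]
        exact tsum_congr fun k => by simp only [c]; ring
      rw [this]
      have hcc : (starRingEnd ℂ) (a 0) * a 0 = ((‖a 0‖ ^ 2 : ℝ) : ℂ) := by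
        rw [mul_comm, Complex.mul_conj, Complex.normSq_eq_norm_sq]
      have hc0 : c 0 = s * al := rfl
      rw [hc0]
      simp only [hal, pow_zero, mul_one, Complex.ofReal_sub, ← hcc, Complex.ofReal_one]
      ring
    rw [e1', e2', norm_mul, Complex.norm_real, Real.norm_eq_abs, abs_of_pos hs0]
    rw [e0'] at hz
    simpa using hz)
  obtain ⟨_, _, hb2⟩ := bo_parseval b hb
  obtain ⟨_, _, hc2⟩ := bo_parseval c hc
  rw [hb2.summable.tsum_eq_zero_add, hc2.summable.tsum_eq_zero_add] at main
  set S := ∑' k, ‖q k‖ ^ 2 with hS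
  have hqS : Summable fun k => ‖q k‖ ^ 2 := (summable_nat_add_iff 1).mpr hb2.summable
  have m2 : ∑' k, ‖c (k + 1)‖ ^ 2 = s ^ 2 * ‖a 0‖ ^ 2 * S := by
    rw [hS, ← tsum_mul_left]
    refine tsum_congr fun k => ?_
    simp only [c, norm_mul, norm_neg, RCLike.norm_conj, Complex.norm_real, Real.norm_eq_abs, mul_pow,
      sq_abs]
  have m3 : ‖c 0‖ ^ 2 = s ^ 2 * (1 - ‖a 0‖ ^ 2) ^ 2 := by
    have hc0 : c 0 = s * al := rfl
    rw [hc0]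
    simp only [hal, norm_mul, Complex.norm_real, Real.norm_eq_abs, mul_pow, sq_abs]
  have m4 : ‖b 0‖ ^ 2 = 0 := by simp [b]
  rw [m2, m3, m4] at main
  have hle : s ^ 2 * (∑ k ∈ Finset.range n, ‖a (k + 1)‖ ^ 2 * (s ^ 2) ^ k) ≤ S := by
    refine le_trans (le_of_eq ?_) (hqS.sum_le_tsum (Finset.range n) (fun _ _ => by positivity))
    rw [Finset.mul_sum]
    refine Finset.sum_congr rfl fun k _ => ?_
    rw [hqn]; ring
  have hpos : 0 ≤ 1 - ‖a 0‖ ^ 2 * s ^ 2 := by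
    have : ‖a 0‖ ^ 2 ≤ 1 := pow_le_one₀ (norm_nonneg _) ha0
    nlinarith [sq_nonneg ‖a 0‖, pow_le_one₀ (n := 2) hs0.le hs1.le]
  have h1 := mul_le_mul_of_nonneg_right hle hpos
  have hs2 : 0 < s ^ 2 := by positivity
  refine le_of_mul_le_mul_left ?_ hs2
  nlinarith

theorem bo_final (x : ℕ → ℝ) (hx : ∀ k, 0 ≤ x k) (a r : ℝ) (ha0 : 0 ≤ a) (ha1 : a ≤ 1)
    (hr0 : 0 < r) (hr1 : r < 1) (hroot : 8 * r ^ 4 + r ^ 2 - 6 * r + 1 = 0)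
    (h : ∀ s : ℝ, 0 < s → s < 1 → ∀ n, (∑ k ∈ Finset.range n, x k ^ 2 * (s ^ 2) ^ k)
      * (1 - a ^ 2 * s ^ 2) ≤ (1 - a ^ 2) ^ 2) (n : ℕ) :
    r * (a + r ^ 2 * ∑ k ∈ Finset.range n, x k * (r ^ 2) ^ k) ≤ 1 := by
  have h' : ∀ R : ℝ, 0 < R → R ≤ 1 → (∑ k ∈ Finset.range n, x k ^ 2 * R ^ k)
      * (1 - a ^ 2 * R) ≤ (1 - a ^ 2) ^ 2 := by
    have hlt : ∀ R : ℝ, 0 < R → R < 1 → (∑ k ∈ Finset.range n, x k ^ 2 * R ^ k)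
      * (1 - a ^ 2 * R) ≤ (1 - a ^ 2) ^ 2 := by
      intro R h0 h1
      have := h (Real.sqrt R) (Real.sqrt_pos.mpr h0) (by rw [Real.sqrt_lt' one_pos]; simpa using h1) n
      rwa [Real.sq_sqrt h0.le] at this
    intro R h0 h1
    rcases h1.lt_or_eq with h1 | rfl
    · exact hlt R h0 h1
    · have hc : Filter.Tendsto (fun R : ℝ => (∑ k ∈ Finset.range n, x k ^ 2 * R ^ k)
          * (1 - a ^ 2 * R)) (nhdsWithin 1 (Set.Iio 1)) (nhds _) :=
        (Continuous.tendsto (by fun_prop) 1).mono_left nhdsWithin_le_nhds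
      refine le_of_tendsto hc ?_
      filter_upwards [Ioo_mem_nhdsLT (show (0:ℝ) < 1 by norm_num)] with t ht
      exact hlt t ht.1 ht.2
  set p := r ^ 2 with hp
  have hp0 : 0 < p := by positivity
  have hp1 : p < 1 := by nlinarith
  have hp2 : 2 * p ^ 2 ≤ 1 := by nlinarith
  set X := ∑ k ∈ Finset.range n, x k * p ^ k with hX
  have hX0 : 0 ≤ X := Finset.sum_nonneg fun k _ => mul_nonneg (hx k) (by positivity)
  have ha2 : a ^ 2 ≤ 1 := pow_le_one₀ ha0 ha1
  have cs : ∀ R : ℝ, 0 < R → R ≤ 1 → p ^ 2 < R →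
      X ^ 2 * ((1 - a ^ 2 * R) * (1 - p ^ 2 / R)) ≤ (1 - a ^ 2) ^ 2 := by
    intro R h0 h1 hpR
    set Q := p ^ 2 / R with hQ
    have hQ0 : 0 ≤ Q := by positivity
    have hQ1 : Q < 1 := (div_lt_one h0).mpr hpR
    have c1 := Finset.sum_sq_le_sum_mul_sum_of_sq_le_mul (Finset.range n)
      (r := fun k => x k * p ^ k) (f := fun k => x k ^ 2 * R ^ k) (g := fun k => Q ^ k)
      (fun k _ => by positivity) (fun k _ => by positivity) (fun k _ => by
        have : R ^ k * Q ^ k = (p ^ 2) ^ k := by rw [← mul_pow, hQ, mul_div_cancel₀ _ h0.ne']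
        rw [mul_assoc, this]; exact le_of_eq (by ring))
    have c2 : (∑ k ∈ Finset.range n, Q ^ k) * (1 - Q) ≤ 1 := by
      have := geom_sum_mul_neg Q n
      rw [this]; linarith [pow_nonneg hQ0 n]
    have c3 := h' R h0 h1
    have hnn : 0 ≤ 1 - a ^ 2 * R := by nlinarith
    have hF : 0 ≤ ∑ k ∈ Finset.range n, x k ^ 2 * R ^ k :=
      Finset.sum_nonneg fun k _ => by positivity
    calc X ^ 2 * ((1 - a ^ 2 * R) * (1 - Q))
        ≤ ((∑ k ∈ Finset.range n, x k ^ 2 * R ^ k) * ∑ k ∈ Finset.range n, Q ^ k)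
            * ((1 - a ^ 2 * R) * (1 - Q)) :=
          mul_le_mul_of_nonneg_right c1 (mul_nonneg hnn (by linarith))
      _ = ((∑ k ∈ Finset.range n, x k ^ 2 * R ^ k) * (1 - a ^ 2 * R)) *
            ((∑ k ∈ Finset.range n, Q ^ k) * (1 - Q)) := by ring
      _ ≤ ((∑ k ∈ Finset.range n, x k ^ 2 * R ^ k) * (1 - a ^ 2 * R)) * 1 :=
          mul_le_mul_of_nonneg_left c2 (mul_nonneg hF hnn)
      _ ≤ _ := by rw [mul_one]; exact c3
  have quad : ∀ y : ℝ, 0 ≤ 2 * p * r * y ^ 2 - (r + p) * y + (1 - p * r) := by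
    intro y
    have e : 8 * p * r * (2 * p * r * y ^ 2 - (r + p) * y + (1 - p * r))
        = (4 * p * r * y - (r + p)) ^ 2 - r ^ 2 * (8 * r ^ 4 + r ^ 2 - 6 * r + 1) := by
      rw [hp]; ring
    rw [hroot] at e
    have hpr : 0 < 8 * p * r := by positivity
    refine nonneg_of_mul_nonneg_right ?_ hpr
    rw [e]; nlinarith [sq_nonneg (4 * p * r * y - (r + p))]
  rcases le_or_gt p a with hpa | hpa
  · have hap : 0 < a := lt_of_lt_of_le hp0 hpa
    have hd : 0 < 1 - a * p := by nlinarith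
    have c := cs (p / a) (by positivity) ((div_le_one hap).mpr hpa) (by
      rw [lt_div_iff₀ hap]; nlinarith)
    have e : (1 - a ^ 2 * (p / a)) * (1 - p ^ 2 / (p / a)) = (1 - a * p) ^ 2 := by
      field_simp
    rw [e, ← mul_pow] at c
    have c' : X * (1 - a * p) ≤ 1 - a ^ 2 := bo_le_of_sq_le_sq (by linarith) c
    refine le_of_mul_le_mul_right ?_ hd
    have q := quad a
    have : r * p * (X * (1 - a * p)) ≤ r * p * (1 - a ^ 2) :=
      mul_le_mul_of_nonneg_left c' (by positivity)
    nlinarith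
  · have c := cs 1 one_pos le_rfl (by nlinarith)
    have ha1' : 0 < 1 - a ^ 2 := by nlinarith
    have hd : 0 < 1 - p ^ 2 := by nlinarith
    have c' : X ^ 2 * (1 - p ^ 2) ≤ 1 - a ^ 2 := by
      refine le_of_mul_le_mul_right ?_ ha1'
      rw [mul_one, div_one] at c
      nlinarith
    have c2 : p * X ≤ 2 * p - a := by
      refine bo_le_of_sq_le_sq (by linarith) ?_
      refine le_of_mul_le_mul_right ?_ hd
      have h1 : p ^ 2 * (X ^ 2 * (1 - p ^ 2)) ≤ p ^ 2 * (1 - a ^ 2) :=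
        mul_le_mul_of_nonneg_left c' (by positivity)
      have h2 : 0 ≤ 2 * p * (p - a) * (1 - 2 * p ^ 2) + (p - a) ^ 2 := by
        have : 0 ≤ p - a := by linarith
        have : 0 ≤ 1 - 2 * p ^ 2 := by linarith
        positivity
      nlinarith
    have q := quad p
    have q2 : 0 ≤ (1 - p ^ 2) * (1 - 2 * p * r) := by nlinarith
    have q3 : 0 ≤ 1 - 2 * p * r := nonneg_of_mul_nonneg_right q2 hd
    nlinarith


/-- Bohr inequality for odd bounded analytic functions in the unit disk:
if `f(z) = ∑_{k≥0} a_{2k+1} z^{2k+1}` with `|f| ≤ 1` on 𝔻 and `r₂` is the maximal root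
in `(0,1)` of `8 r^4 + r^2 - 6 r + 1 = 0`, then the majorant series of `f` is at most `1`
for all `0 ≤ r ≤ r₂`. -/
theorem bohr_odd (f : ℂ → ℂ) (a : ℕ → ℂ)
    (hf : ∀ z ∈ Metric.ball (0 : ℂ) 1, HasSum (fun k : ℕ => a k * z ^ (2 * k + 1)) (f z))
    (hb : ∀ z ∈ Metric.ball (0 : ℂ) 1, ‖f z‖ ≤ 1)
    (r2 : ℝ) (hr2 : r2 ∈ Set.Ioo (0 : ℝ) 1)
    (hroot : 8 * r2 ^ 4 + r2 ^ 2 - 6 * r2 + 1 = 0)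
    (hmax : ∀ s ∈ Set.Ioo (0 : ℝ) 1, 8 * s ^ 4 + s ^ 2 - 6 * s + 1 = 0 → s ≤ r2) :
    ∀ r : ℝ, 0 ≤ r → r ≤ r2 → ∑' k : ℕ, ‖a k‖ * r ^ (2 * k + 1) ≤ 1 := by
  have hsum1 : ∀ s : ℝ, 0 ≤ s → s < 1 → Summable fun k => ‖a k‖ * s ^ (2 * k + 1) := by
    intro s h0 h1
    have := (hf (s : ℂ) (by simpa [abs_of_nonneg h0] using h1)).summable.norm
    simpa [abs_of_nonneg h0] using this
  have hsum : ∀ s : ℝ, 0 < s → s < 1 → Summable fun k => ‖a k‖ * s ^ k := by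
    intro s h0 h1
    have hq0 := Real.sqrt_pos.mpr h0
    have := hsum1 (Real.sqrt s) (Real.sqrt_nonneg s)
      (by rw [Real.sqrt_lt' one_pos]; simpa using h1)
    refine (this.mul_left (Real.sqrt s)⁻¹).congr fun k => ?_
    rw [pow_succ, pow_mul, Real.sq_sqrt h0.le]
    field_simp
  let g : ℂ → ℂ := fun w => ∑' k, a k * w ^ k
  have hg0 : g 0 = a 0 := by
    simp only [g]
    rw [tsum_eq_single 0]
    · simp
    · intro k hk; simp [hk]
  have hgd : DifferentiableOn ℂ g (Metric.ball 0 1) := by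
    intro z hz
    have hz1 : ‖z‖ < 1 := by simpa using hz
    obtain ⟨s, hs, hs1⟩ := exists_between hz1
    have hs0 : 0 < s := (norm_nonneg z).trans_lt hs
    have := Complex.differentiableOn_tsum_of_summable_norm (U := Metric.ball (0:ℂ) s)
      (F := fun k w => a k * w ^ k) (hsum s hs0 hs1) (fun k => by fun_prop) Metric.isOpen_ball
      (fun k w hw => by
        have : ‖w‖ ≤ s := by simpa using (le_of_lt (by simpa using hw : ‖w‖ < s))
        rw [norm_mul, norm_pow]
        gcongr)
    exact (this.differentiableAt (Metric.isOpen_ball.mem_nhds (by simpa using hs))).differentiableWithinAt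
  have hsq : ∀ z ∈ Metric.ball (0:ℂ) 1, z ^ 2 ∈ Metric.ball (0:ℂ) 1 := by
    intro z hz
    have hz1 : ‖z‖ < 1 := by simpa using hz
    simpa using pow_lt_one₀ (norm_nonneg z) hz1 two_ne_zero
  have hfg : ∀ z ∈ Metric.ball (0:ℂ) 1, z * g (z ^ 2) = f z := by
    intro z hz
    rw [← (hf z hz).tsum_eq]
    simp only [g]
    rw [← tsum_mul_left]
    exact tsum_congr fun k => by rw [← pow_mul]; ring
  have hFd : DifferentiableOn ℂ (fun z => z * g (z ^ 2)) (Metric.ball 0 1) :=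
    differentiableOn_id.mul (hgd.comp (by fun_prop) hsq)
  have hFm : Set.MapsTo (fun z => z * g (z ^ 2)) (Metric.ball 0 1) (Metric.closedBall 0 1) := by
    intro z hz
    simp only [mem_closedBall_zero_iff]
    rw [hfg z hz]; exact hb z hz
  have hg1 : ∀ w ∈ Metric.ball (0:ℂ) 1, ‖g w‖ ≤ 1 := by
    intro w hw
    by_cases hw0 : w = 0
    · have hder := Complex.norm_deriv_le_one_of_mapsTo_ball hFd (by simpa using hFm) one_pos
      have hgat : DifferentiableAt ℂ (fun z => g (z ^ 2)) 0 := by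
        have : DifferentiableOn ℂ (fun z => g (z ^ 2)) (Metric.ball 0 1) :=
          hgd.comp (by fun_prop) hsq
        exact this.differentiableAt (Metric.isOpen_ball.mem_nhds (by simp))
      have hd := (hasDerivAt_id (0:ℂ)).mul hgat.hasDerivAt
      have hd' : deriv (fun z => z * g (z ^ 2)) 0 = g 0 := by
        have := hd.deriv
        rw [show (fun z => z * g (z ^ 2)) = id * fun z => g (z ^ 2) from rfl]
        simpa using this
      rw [hd'] at hder
      rw [hw0]; exact hder
    · obtain ⟨z, hz⟩ := (IsAlgClosed.exists_pow_nat_eq w two_pos).imp fun _ h => h.symm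
      have hz1 : ‖z‖ < 1 := by
        have : ‖w‖ < 1 := by simpa using hw
        rw [hz, norm_pow] at this
        exact (pow_lt_one_iff_of_nonneg (norm_nonneg _) two_ne_zero).mp this
      have hz0 : z ≠ 0 := by rintro rfl; simp at hz; exact hw0 hz
      have := Complex.norm_le_norm_of_mapsTo_ball hFd hFm (by simp) hz1
      rw [norm_mul, ← hz] at this
      have hzp := norm_pos_iff.mpr hz0
      nlinarith
  have ha0 : ‖a 0‖ ≤ 1 := by rw [← hg0]; exact hg1 0 (by simp)
  have hfin := bo_final (fun k => ‖a (k + 1)‖) (fun k => norm_nonneg _) ‖a 0‖ r2 (norm_nonneg _) ha0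
    hr2.1 hr2.2 hroot (by
      intro s h0 h1 n
      refine bo_coeff a s h0 (hsum s h0 h1) ?_ h1 ha0 n
      intro z hz
      have := bo_pick g hgd hg1 z (by simp [hz, h1])
      rw [hg0, hz] at this
      exact this)
  intro r hr0 hr
  refine Real.tsum_le_of_sum_range_le (fun k => by positivity) fun n => ?_
  calc ∑ k ∈ Finset.range n, ‖a k‖ * r ^ (2 * k + 1)
      ≤ ∑ k ∈ Finset.range n, ‖a k‖ * r2 ^ (2 * k + 1) := by gcongr
    _ ≤ ∑ k ∈ Finset.range (n + 1), ‖a k‖ * r2 ^ (2 * k + 1) := by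
        rw [Finset.sum_range_succ]
        have := hr2.1
        have : 0 ≤ ‖a n‖ * r2 ^ (2 * n + 1) := by positivity
        linarith
    _ = r2 * (‖a 0‖ + r2 ^ 2 * ∑ k ∈ Finset.range n, ‖a (k + 1)‖ * (r2 ^ 2) ^ k) := by
        rw [Finset.sum_range_succ', mul_add, Finset.mul_sum, Finset.mul_sum, add_comm]
        congr 1
        · ring
        · exact Finset.sum_congr rfl fun k _ => by rw [← pow_mul]; ring
    _ ≤ 1 := hfin n
end

section
/- Let f and g be analytic in the unit disk 𝔻, where f(z) = z + ∑_{k≥2} a_{2k−1} z^{2k−1} is odd, univalent (injective) on 𝔻, and g(z) = ∑_{n≥1} b_n z^n is subordinate to f. Then ∑_{n≥1} |b_n| r^n ≤ 1 for all 0 ≤ r ≤ r_*, where r_* = 0.554958… is the minimal positive root of the equation x^2 = (1−x)^2 (1+x). -/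
open Metric Filter Topology MeasureTheory



/-- `u` is the sum of the power series with coefficients `c` on the unit disk. -/
def PS (u : ℂ → ℂ) (c : ℕ → ℂ) : Prop := ∀ z : ℂ, ‖z‖ < 1 → HasSum (fun n => c n * z ^ n) (u z)

theorem PS.summable_norm {u c} (h : PS u c) {t : ℝ} (h0 : 0 ≤ t) (h1 : t < 1) :
    Summable (fun n => ‖c n‖ * t ^ n) := by
  have := (h (t : ℂ) (by simpa [abs_of_nonneg h0] using h1)).summable.norm
  simpa [abs_of_nonneg h0] using this

theorem PS.unique {u c d} (h : PS u c) (h' : PS u d) : c = d := by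
  have key : ∀ e, PS u e → HasFPowerSeriesAt u (FormalMultilinearSeries.ofScalars ℂ e) 0 := by
    intro e he
    rw [hasFPowerSeriesAt_iff]
    filter_upwards [ball_mem_nhds (0:ℂ) one_pos] with z hz
    have := he z (by simpa using hz)
    simpa [FormalMultilinearSeries.coeff_ofScalars, mul_comm] using this
  have := (key c h).eq_formalMultilinearSeries (key d h')
  funext n
  have h3 := congrArg (fun p => FormalMultilinearSeries.coeff p n) this
  simpa [FormalMultilinearSeries.coeff_ofScalars] using h3

theorem PS.taylor {u : ℂ → ℂ} (h : DifferentiableOn ℂ u (ball 0 1)) :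
    PS u (fun n => (n.factorial : ℂ)⁻¹ * iteratedDeriv n u 0) := by
  intro z hz
  have := Complex.hasSum_taylorSeries_on_ball h (z := z) (by simpa using hz)
  refine HasSum.congr_fun this fun n => ?_
  simp; ring

theorem PS.differentiableOn {u c} (h : PS u c) : DifferentiableOn ℂ u (ball 0 1) := by
  intro z hz
  have hz' : ‖z‖ < 1 := by simpa using hz
  obtain ⟨t, ht1, ht2⟩ := exists_between hz'
  have h0 : 0 ≤ t := (norm_nonneg z).trans ht1.le
  have := Complex.differentiableOn_tsum_of_summable_norm (h.summable_norm h0 ht2)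
    (F := fun n z => c n * z ^ n) (U := ball 0 t) (fun i => by fun_prop) isOpen_ball
    (fun i w hw => by
      have : ‖w‖ ≤ t := by simpa using (mem_ball.1 hw).le
      simp only [norm_mul, norm_pow]; gcongr)
  have h2 := (this z (by simpa using ht1)).differentiableAt (isOpen_ball.mem_nhds (by simpa using ht1))
  refine (h2.congr_of_eventuallyEq ?_).differentiableWithinAt
  filter_upwards [isOpen_ball.mem_nhds hz] with w hw
  exact (h w (by simpa using hw)).tsum_eq.symm

theorem PS.congr {u v c} (h : PS u c) (huv : ∀ z, ‖z‖ < 1 → v z = u z) : PS v c :=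
  fun z hz => by rw [huv z hz]; exact h z hz

theorem PS.mul {u v c d} (h : PS u c) (h' : PS v d) :
    PS (fun z => u z * v z) (fun n => ∑ p ∈ Finset.HasAntidiagonal.antidiagonal n, c p.1 * d p.2) := by
  intro z hz
  have e : ∀ n, (∑ p ∈ Finset.HasAntidiagonal.antidiagonal n, c p.1 * d p.2) * z ^ n
      = ∑ p ∈ Finset.HasAntidiagonal.antidiagonal n, (c p.1 * z ^ p.1) * (d p.2 * z ^ p.2) := by
    intro n
    rw [Finset.sum_mul]
    refine Finset.sum_congr rfl fun p hp => ?_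
    rw [← Finset.HasAntidiagonal.mem_antidiagonal.1 hp]; ring
  simp only [e]
  have s1 := (h z hz).summable.norm
  have s2 := (h' z hz).summable.norm
  rw [← (h z hz).tsum_eq, ← (h' z hz).tsum_eq,
    tsum_mul_tsum_eq_tsum_sum_antidiagonal_of_summable_norm s1 s2]
  exact (summable_norm_sum_mul_antidiagonal_of_summable_norm s1 s2).of_norm.hasSum

/-- Shifted coefficient sequence. -/
def shiftC (a : ℂ) (c : ℕ → ℂ) : ℕ → ℂ
  | 0 => a
  | n + 1 => c n

theorem PS.shift {u c} (a : ℂ) (h : PS u c) :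
    PS (fun z => a + z * u z) (shiftC a c) := by
  intro z hz
  rw [← hasSum_nat_add_iff' 1]
  simp only [Finset.range_one, Finset.sum_singleton, pow_zero, mul_one, shiftC, add_sub_cancel_left]
  have := (h z hz).mul_left z
  refine HasSum.congr_fun this fun n => ?_
  ring

theorem PS.deriv {u c} (h : PS u c) : PS (deriv u) (fun n => (n + 1) * c (n + 1)) := by
  have hc := h.unique (PS.taylor h.differentiableOn)
  have hd : DifferentiableOn ℂ (_root_.deriv u) (ball 0 1) := h.differentiableOn.deriv isOpen_ball
  have := PS.taylor hd
  convert this using 2 with n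
  rw [hc]
  simp only [iteratedDeriv_succ', Nat.factorial_succ]
  push_cast
  have : (n : ℂ) + 1 ≠ 0 := by exact_mod_cast n.succ_ne_zero
  field_simp

theorem PS.sub {u v c d} (h : PS u c) (h' : PS v d) :
    PS (fun z => u z - v z) (fun n => c n - d n) := fun z hz => by
  simpa [sub_mul] using (h z hz).sub (h' z hz)

theorem PS.zero_eq {u c} (h : PS u c) : u 0 = c 0 := by
  have := (h 0 (by simp)).unique (hasSum_single 0 (by intro b hb; simp [hb]))
  simpa using this

theorem circle_orth (m n : ℕ) : ∫ θ in (-Real.pi)..Real.pi,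
    Complex.exp (θ * Complex.I) ^ m * (starRingEnd ℂ) (Complex.exp (θ * Complex.I) ^ n)
      = if m = n then 2 * Real.pi else 0 := by
  have e : ∀ θ : ℝ, Complex.exp (θ * Complex.I) ^ m * (starRingEnd ℂ) (Complex.exp (θ * Complex.I) ^ n)
      = Complex.exp (((m:ℂ) - n) * Complex.I * θ) := by
    intro θ
    rw [map_pow, ← Complex.exp_conj, ← Complex.exp_nat_mul, ← Complex.exp_nat_mul, ← Complex.exp_add]
    congr 1; simp; ring
  simp only [e]
  split_ifs with h
  · subst h; simp; ring
  · have h' : (m : ℂ) - n ≠ 0 := by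
      rw [sub_ne_zero]; exact_mod_cast h
    rw [integral_exp_mul_complex (mul_ne_zero h' Complex.I_ne_zero)]
    have : Complex.exp (((m:ℂ) - n) * Complex.I * (Real.pi:ℝ))
       = Complex.exp (((m:ℂ) - n) * Complex.I * ((-Real.pi : ℝ):ℂ)) := by
      rw [Complex.exp_eq_exp_iff_exists_int]
      refine ⟨(m:ℤ) - n, ?_⟩
      push_cast; ring
    rw [this]; simp

/-- Parseval. -/
theorem PS.parseval {u c} (h : PS u c) {t : ℝ} (h0 : 0 ≤ t) (h1 : t < 1) :
    HasSum (fun n => 2 * Real.pi * (‖c n‖ ^ 2 * t ^ (2 * n)))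
      (∫ θ in (-Real.pi)..Real.pi, ‖u (t * Complex.exp (θ * Complex.I))‖ ^ 2) := by
  set E : ℝ → ℂ := fun θ => Complex.exp (θ * Complex.I) with hE
  have hEc : Continuous E := by fun_prop
  have hEn : ∀ θ, ‖E θ‖ = 1 := fun θ => by simp [hE, Complex.norm_exp_ofReal_mul_I]
  have hn : ∀ θ, ‖(t * E θ : ℂ)‖ < 1 := fun θ => by simp [hEn, abs_of_nonneg h0, h1]
  have hs := h.summable_norm h0 h1
  have huc : Continuous (fun θ => u (t * E θ)) := by
    refine h.differentiableOn.continuousOn.comp_continuous (by fun_prop) (fun θ => by simpa using hn θ)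
  have hle : -Real.pi ≤ Real.pi := by linarith [Real.pi_pos]
  -- coefficient extraction
  have co : ∀ k, ∫ θ in (-Real.pi)..Real.pi, u (t * E θ) * (starRingEnd ℂ) (E θ ^ k)
      = 2 * Real.pi * (c k * t ^ k) := by
    intro k
    have H := intervalIntegral.hasSum_integral_of_dominated_convergence (μ := volume)
      (a := -Real.pi) (b := Real.pi)
      (F := fun n θ => (c n * (t * E θ) ^ n) * (starRingEnd ℂ) (E θ ^ k))
      (f := fun θ => u (t * E θ) * (starRingEnd ℂ) (E θ ^ k))
      (fun n _ => ‖c n‖ * t ^ n) (fun n => by fun_prop)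
      (fun n => by
        refine Eventually.of_forall fun θ _ => le_of_eq ?_
        simp [hEn, abs_of_nonneg h0])
      (Eventually.of_forall fun θ _ => hs)
      (by simp)
      (Eventually.of_forall fun θ _ => (h _ (hn θ)).mul_right _)
    refine H.unique ?_
    have e : ∀ n, ∫ θ in (-Real.pi)..Real.pi, (c n * (t * E θ) ^ n) * (starRingEnd ℂ) (E θ ^ k)
       = (c n * t ^ n) * (if n = k then 2 * Real.pi else 0) := by
      intro n
      rw [← circle_orth, ← intervalIntegral.integral_const_mul]
      congr 1; ext θ; simp only [hE]; ring
    simp only [e]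
    convert hasSum_single k ?_ using 1
    · simp; ring
    · intro b hb; simp [hb]
  have H := intervalIntegral.hasSum_integral_of_dominated_convergence (μ := volume)
      (a := -Real.pi) (b := Real.pi)
      (F := fun n θ => u (t * E θ) * (starRingEnd ℂ) (c n * (t * E θ) ^ n))
      (f := fun θ => u (t * E θ) * (starRingEnd ℂ) (u (t * E θ)))
      (fun n θ => ‖u (t * E θ)‖ * (‖c n‖ * t ^ n))
      (fun n => (huc.mul (by fun_prop)).aestronglyMeasurable)
      (fun n => by
        refine Eventually.of_forall fun θ _ => le_of_eq ?_
        simp [hEn, abs_of_nonneg h0])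
      (Eventually.of_forall fun θ _ => hs.mul_left _)
      (by
        simp only [tsum_mul_left]
        exact (huc.norm.mul continuous_const).intervalIntegrable _ _)
      (Eventually.of_forall fun θ _ => by
        have := (h _ (hn θ))
        exact (Complex.hasSum_conj'.mpr this).mul_left _)
  have e1 : ∀ n, ∫ θ in (-Real.pi)..Real.pi, u (t * E θ) * (starRingEnd ℂ) (c n * (t * E θ) ^ n)
      = ((2 * Real.pi * (‖c n‖ ^ 2 * t ^ (2 * n)) : ℝ) : ℂ) := by
    intro n
    have : ∀ θ, u (t * E θ) * (starRingEnd ℂ) (c n * (t * E θ) ^ n)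
      = (starRingEnd ℂ) (c n) * t ^ n * (u (t * E θ) * (starRingEnd ℂ) (E θ ^ n)) := by
      intro θ; simp; ring
    simp only [this]
    rw [intervalIntegral.integral_const_mul, co n]
    push_cast
    rw [← Complex.conj_mul']
    ring
  have e2 : ∫ θ in (-Real.pi)..Real.pi, u (t * E θ) * (starRingEnd ℂ) (u (t * E θ))
     = ((∫ θ in (-Real.pi)..Real.pi, ‖u (t * E θ)‖ ^ 2 : ℝ) : ℂ) := by
    rw [← intervalIntegral.integral_ofReal]
    congr 1; ext θ; rw [Complex.mul_conj']; push_cast; rfl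
  rw [e2] at H
  simp only [e1] at H
  exact_mod_cast H


theorem le_of_lt_one_limit {p : ℝ → ℝ} {C : ℝ} (hp : Continuous p)
    (h : ∀ t, 0 < t → t < 1 → p t ≤ C) : p 1 ≤ C := by
  have h1 : Tendsto p (𝓝[<] 1) (𝓝 (p 1)) := hp.continuousAt.tendsto.mono_left nhdsWithin_le_nhds
  refine le_of_tendsto h1 ?_
  filter_upwards [Ioo_mem_nhdsLT (zero_lt_one (α := ℝ))] with t ht
  exact h t ht.1 ht.2

theorem mult_contr {v d} (hv : PS v d) (hb : ∀ z, ‖z‖ < 1 → ‖v z‖ ≤ 1) (φ : ℕ → ℂ) (N : ℕ) :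
    ∑ n ∈ Finset.range N, ‖∑ p ∈ Finset.HasAntidiagonal.antidiagonal n, d p.1 * φ p.2‖ ^ 2
      ≤ ∑ n ∈ Finset.range N, ‖φ n‖ ^ 2 := by
  set ψ : ℕ → ℂ := fun n => if n < N then φ n else 0 with hψ
  set P : ℂ → ℂ := fun z => ∑ n ∈ Finset.range N, ψ n * z ^ n with hP
  have hPS : PS P ψ := by
    intro z _
    apply hasSum_sum_of_ne_finset_zero
    intro b hb
    have : ¬ b < N := by simpa using hb
    simp [hψ, this]
  have hm := hv.mul hPS
  have key : ∀ t : ℝ, 0 < t → t < 1 →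
      ∑ n ∈ Finset.range N, ‖∑ p ∈ Finset.HasAntidiagonal.antidiagonal n, d p.1 * φ p.2‖ ^ 2 * t ^ (2 * n)
      ≤ ∑ n ∈ Finset.range N, ‖φ n‖ ^ 2 := by
    intro t h0 h1
    have p1 := hm.parseval h0.le h1
    have p2 := hPS.parseval h0.le h1
    have hn : ∀ θ : ℝ, ‖(t * Complex.exp (θ * Complex.I) : ℂ)‖ < 1 := fun θ => by
      simp [Complex.norm_exp_ofReal_mul_I, abs_of_pos h0, h1]
    have hcont : ∀ u : ℂ → ℂ, DifferentiableOn ℂ u (ball 0 1) →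
        IntervalIntegrable (fun θ : ℝ => ‖u (t * Complex.exp (θ * Complex.I))‖ ^ 2) volume
          (-Real.pi) Real.pi := by
      intro u hu
      apply Continuous.intervalIntegrable
      have : Continuous (fun θ : ℝ => u (t * Complex.exp (θ * Complex.I))) :=
        hu.continuousOn.comp_continuous (by fun_prop) (fun θ => by simpa using hn θ)
      exact this.norm.pow 2
    have i1 := intervalIntegral.integral_mono (by linarith [Real.pi_pos])
      (hcont _ hm.differentiableOn) (hcont _ hPS.differentiableOn)
      (fun θ => by
        have := hb _ (hn θ)
        simp only [norm_mul]
        gcongr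
        exact mul_le_of_le_one_left (norm_nonneg _) this)
    have q1 := sum_le_hasSum (Finset.range N) (fun i _ => by positivity) p1
    have q2 : HasSum (fun n => 2 * Real.pi * (‖ψ n‖ ^ 2 * t ^ (2 * n))) _ :=
      hasSum_sum_of_ne_finset_zero (s := Finset.range N) (by
        intro b hb
        have : ¬ b < N := by simpa using hb
        simp [hψ, this])
    have q3 := p2.unique q2
    have q4 := (q1.trans i1).trans_eq q3
    rw [← Finset.mul_sum, ← Finset.mul_sum] at q4
    have q5 := le_of_mul_le_mul_left q4 (by positivity)
    have e1 : ∀ n ∈ Finset.range N, ‖∑ p ∈ Finset.HasAntidiagonal.antidiagonal n, d p.1 * φ p.2‖ ^ 2 * t ^ (2 * n)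
       = ‖∑ p ∈ Finset.HasAntidiagonal.antidiagonal n, d p.1 * ψ p.2‖ ^ 2 * t ^ (2 * n) := by
      intro n hn
      congr 3
      refine Finset.sum_congr rfl fun p hp => ?_
      have h1 := Finset.HasAntidiagonal.mem_antidiagonal.1 hp
      have h2 := Finset.mem_range.1 hn
      have : p.2 < N := by omega
      simp [hψ, this]
    rw [Finset.sum_congr rfl e1]
    refine q5.trans (Finset.sum_le_sum fun n hn => ?_)
    have : n < N := Finset.mem_range.1 hn
    simp only [hψ, this, if_true]
    exact mul_le_of_le_one_right (by positivity) (pow_le_one₀ h0.le h1.le)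
  have := le_of_lt_one_limit (by fun_prop) key
  simpa using this

theorem rogosinski {w : ℂ → ℂ} (hw : DifferentiableOn ℂ w (ball 0 1)) (hw0 : w 0 = 0)
    (hwm : ∀ z, ‖z‖ < 1 → ‖w z‖ < 1) (N : ℕ) : ∀ (f : ℂ → ℂ) (a b : ℕ → ℂ), PS f a →
    PS (fun z => f (w z)) b → ∑ n ∈ Finset.range N, ‖b n‖ ^ 2 ≤ ∑ n ∈ Finset.range N, ‖a n‖ ^ 2 := by
  have h01 : ball (0:ℂ) 1 ∈ 𝓝 (0:ℂ) := ball_mem_nhds _ one_pos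
  have hmaps : Set.MapsTo w (ball 0 1) (ball 0 1) := fun z hz => by
    simpa using hwm z (by simpa using hz)
  set v := dslope w 0 with hv
  have hvd : DifferentiableOn ℂ v (ball 0 1) := (Complex.differentiableOn_dslope h01).2 hw
  have hvb : ∀ z, ‖z‖ < 1 → ‖v z‖ ≤ 1 := by
    intro z hz
    have := Complex.norm_dslope_le_div_of_mapsTo_ball (R₂ := 1) hw
      (by rw [hw0]; exact hmaps.mono_right ball_subset_closedBall) (z := z) (by simpa using hz)
    simpa using this
  have hvw : ∀ z, w z = z * v z := fun z => by
    have := sub_smul_dslope w 0 z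
    simpa [hw0] using this.symm
  obtain ⟨d, hvP⟩ : ∃ d, PS v d := ⟨_, PS.taylor hvd⟩
  induction N with
  | zero => simp
  | succ N ih =>
    intro f a b hf hb
    set F := dslope f 0 with hF
    have hFd : DifferentiableOn ℂ F (ball 0 1) :=
      (Complex.differentiableOn_dslope h01).2 hf.differentiableOn
    have hFf : ∀ z, f z = a 0 + z * F z := fun z => by
      have := sub_smul_dslope f 0 z
      simp only [sub_zero, smul_eq_mul, ← hF, hf.zero_eq] at this
      rw [this]; ring
    obtain ⟨A, hFP⟩ : ∃ d, PS F d := ⟨_, PS.taylor hFd⟩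
    obtain ⟨B, hcP⟩ : ∃ d, PS (fun z => F (w z)) d := ⟨_, PS.taylor (hFd.comp hw hmaps)⟩
    have e1 := hf.unique ((hFP.shift (a 0)).congr fun z _ => hFf z)
    have e2 := hb.unique (((hvP.mul hcP).shift (a 0)).congr fun z _ => by
      rw [hFf]; linear_combination F (w z) * hvw z)
    have e1' : ∀ n, a (n + 1) = A n := fun n => congrFun e1 (n + 1)
    have e2' := fun n => congrFun e2 (n + 1)
    have e20 : b 0 = a 0 := congrFun e2 0
    simp only [shiftC] at e2'
    rw [Finset.sum_range_succ', Finset.sum_range_succ', e20]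
    simp only [e1', e2']
    have := (mult_contr hvP hvb B N).trans (ih F A B hFP hcP)
    linarith


theorem det_form (M : ℂ →L[ℝ] ℂ) :
    M.det = (M 1).re * (M Complex.I).im - (M Complex.I).re * (M 1).im := by
  rw [ContinuousLinearMap.det, ← LinearMap.det_toMatrix Complex.basisOneI, Matrix.det_fin_two]
  simp [LinearMap.toMatrix_apply]

/-- The real-linear map `z ↦ h z - k * conj (h z)`. -/
noncomputable def linMap (k h : ℂ) : ℂ →L[ℝ] ℂ :=
  (ContinuousLinearMap.id ℝ ℂ - (ContinuousLinearMap.mul ℝ ℂ k).comp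
    (Complex.conjCLE : ℂ →L[ℝ] ℂ)).comp (ContinuousLinearMap.mul ℝ ℂ h)

theorem linMap_apply (k h z : ℂ) : linMap k h z = h * z - k * (starRingEnd ℂ) (h * z) := by
  simp [linMap]

theorem linMap_det (k h : ℂ) : (linMap k h).det = (1 - ‖k‖ ^ 2) * ‖h‖ ^ 2 := by
  rw [det_form, linMap_apply, linMap_apply, Complex.sq_norm, Complex.sq_norm,
    Complex.normSq_apply, Complex.normSq_apply]
  simp
  ring

theorem hasFDeriv_lin {H : ℂ → ℂ} {h z k : ℂ} (hH : HasDerivAt H h z) :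
    HasFDerivAt (fun z => H z - k * (starRingEnd ℂ) (H z)) (linMap k h) z := by
  have h1 := (hH.hasFDerivAt.restrictScalars ℝ)
  have h2 := ((ContinuousLinearMap.id ℝ ℂ - (ContinuousLinearMap.mul ℝ ℂ k).comp
    (Complex.conjCLE : ℂ →L[ℝ] ℂ)).hasFDerivAt (x := H z)).comp z h1
  have h3 := h2.congr_fderiv (g' := linMap k h) (by
    apply ContinuousLinearMap.ext; intro x; rw [linMap_apply]; simp [mul_comm])
  refine h3.congr_of_eventuallyEq (Eventually.of_forall fun x => ?_)
  simp

theorem lin_inj {k : ℂ} (hk : ‖k‖ < 1) {x y : ℂ}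
    (h : x - k * (starRingEnd ℂ) x = y - k * (starRingEnd ℂ) y) : x = y := by
  have h1 : x - y = k * (starRingEnd ℂ) (x - y) := by
    rw [map_sub]; linear_combination h
  have h2 := congrArg norm h1
  rw [norm_mul, RCLike.norm_conj] at h2
  by_contra hne
  have : 0 < ‖x - y‖ := norm_pos_iff.2 (sub_ne_zero.2 hne)
  nlinarith

/-- The area function. -/
noncomputable def Gf (c : ℕ → ℂ) (N : ℕ) (t : ℝ) : ℝ :=
  Real.pi * ((∑ k ∈ Finset.range N, ((k:ℝ) - 1) * ‖c k‖ ^ 2 * t ^ (2 * k)) / t ^ 2)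

noncomputable def gf (c : ℕ → ℂ) (N : ℕ) (t : ℝ) : ℝ :=
  2 * Real.pi * ((∑ k ∈ Finset.range N, ((k:ℝ) - 1) ^ 2 * ‖c k‖ ^ 2 * t ^ (2 * k)) / t ^ 3)

theorem Gf_deriv (c : ℕ → ℂ) (N : ℕ) {t : ℝ} (ht : t ≠ 0) : HasDerivAt (Gf c N) (gf c N t) t := by
  have h1 : HasDerivAt (fun t : ℝ => ∑ k ∈ Finset.range N, ((k:ℝ) - 1) * ‖c k‖ ^ 2 * t ^ (2 * k))
      (∑ k ∈ Finset.range N, ((k:ℝ) - 1) * ‖c k‖ ^ 2 * ((2 * k : ℕ) * t ^ (2 * k - 1))) t :=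
    HasDerivAt.fun_sum fun k _ => (hasDerivAt_pow _ _).const_mul _
  have h2 := (h1.div (hasDerivAt_pow 2 t) (pow_ne_zero 2 ht)).const_mul Real.pi
  refine h2.congr_deriv ?_
  unfold gf
  have e : (∑ k ∈ Finset.range N, ((k:ℝ) - 1) * ‖c k‖ ^ 2 * ((2 * k : ℕ) * t ^ (2 * k - 1))) * t
    = ∑ k ∈ Finset.range N, ((k:ℝ) - 1) * ‖c k‖ ^ 2 * (2 * k) * t ^ (2 * k) := by
    rw [Finset.sum_mul]
    refine Finset.sum_congr rfl fun k _ => ?_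
    rcases k with _ | k
    · simp
    · have : 2 * (k + 1) - 1 = 2 * k + 1 := by omega
      rw [this]; push_cast; ring
  have e2 : ∑ k ∈ Finset.range N, ((k:ℝ) - 1) * ‖c k‖ ^ 2 * (2 * k) * t ^ (2 * k)
     = 2 * (∑ k ∈ Finset.range N, ((k:ℝ) - 1) ^ 2 * ‖c k‖ ^ 2 * t ^ (2 * k))
       + 2 * (∑ k ∈ Finset.range N, ((k:ℝ) - 1) * ‖c k‖ ^ 2 * t ^ (2 * k)) := by
    rw [Finset.mul_sum, Finset.mul_sum, ← Finset.sum_add_distrib]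
    refine Finset.sum_congr rfl fun k _ => ?_
    ring
  rw [e2] at e
  generalize (∑ k ∈ Finset.range N, ((k:ℝ) - 1) * ‖c k‖ ^ 2 * ((2 * k : ℕ) * t ^ (2 * k - 1))) = X at *
  field_simp
  simp only [Nat.cast_ofNat]
  linear_combination t * e

theorem chi_PS {e c} (he : PS e c) :
    PS (fun z => z * deriv e z - e z) (fun n => ((n:ℂ) - 1) * c n) := by
  have h1 := (he.deriv.shift 0).sub he
  have : (fun n : ℕ => shiftC 0 (fun n : ℕ => ((n:ℂ) + 1) * c (n + 1)) n - c n)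
      = (fun n : ℕ => ((n:ℂ) - 1) * c n) := by
    funext n
    rcases n with _ | n
    · simp [shiftC]
    · simp [shiftC]; ring
  rw [this] at h1
  exact h1.congr fun z _ => by ring

theorem area_ineq {e c} (he : PS e c)
    (hinj : Set.InjOn (fun z => e z / z) (ball 0 1 \ {0})) (N : ℕ) {δ ρ R : ℝ} (hδ : 0 < δ)
    (hδρ : δ < ρ) (hρ : ρ < 1) {k : ℂ} (hk : ‖k‖ < 1) (hR0 : 0 ≤ R)
    (hR : ∀ z : ℂ, δ < ‖z‖ → ‖z‖ < ρ → ‖e z / z - k * (starRingEnd ℂ) (e z / z)‖ < R) :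
    (1 - ‖k‖ ^ 2) * (Gf c N ρ - Gf c N δ) ≤ Real.pi * R ^ 2 := by
  set A : Set ℂ := {z | δ < ‖z‖ ∧ ‖z‖ < ρ} with hA
  have hAo : IsOpen A := (isOpen_lt continuous_const continuous_norm).inter
    (isOpen_lt continuous_norm continuous_const)
  have hA0 : ∀ z ∈ A, z ≠ 0 := fun z hz => norm_pos_iff.1 (hδ.trans hz.1)
  have hA1 : ∀ z ∈ A, ‖z‖ < 1 := fun z hz => hz.2.trans hρ
  set χ : ℂ → ℂ := fun z => z * deriv e z - e z with hχ
  have hχP := chi_PS he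
  have hder : ∀ z ∈ A, HasDerivAt (fun z => e z / z) (χ z / z ^ 2) z := by
    intro z hz
    have h1 : DifferentiableAt ℂ e z := (he.differentiableOn z (by simpa using hA1 z hz)).differentiableAt
      (isOpen_ball.mem_nhds (by simpa using hA1 z hz))
    have := h1.hasDerivAt.div (hasDerivAt_id z) (hA0 z hz)
    refine this.congr_deriv ?_
    simp [hχ]; ring
  set κ : ℝ := 1 - ‖k‖ ^ 2 with hκ
  have hκ0 : 0 < κ := by have := norm_nonneg k; rw [hκ]; nlinarith
  have cv := lintegral_abs_det_fderiv_eq_addHaar_image (volume : Measure ℂ) hAo.measurableSet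
    (f := fun z => e z / z - k * (starRingEnd ℂ) (e z / z))
    (f' := fun z => linMap k (χ z / z ^ 2))
    (fun z hz => (hasFDeriv_lin (hder z hz)).hasFDerivWithinAt)
    (fun x hx y hy hxy => hinj ⟨by simpa using hA1 x hx, hA0 x hx⟩ ⟨by simpa using hA1 y hy, hA0 y hy⟩
      (lin_inj hk hxy))
  have up : volume ((fun z => e z / z - k * (starRingEnd ℂ) (e z / z)) '' A)
      ≤ ENNReal.ofReal (Real.pi * R ^ 2) := by
    calc _ ≤ volume (ball (0:ℂ) R) := by
          apply measure_mono
          rintro _ ⟨z, hz, rfl⟩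
          simpa using hR z hz.1 hz.2
      _ = _ := by
          rw [Complex.volume_ball, ENNReal.ofReal_mul Real.pi_pos.le, ← ENNReal.ofReal_pow hR0, mul_comm]
          congr 1
          rw [← NNReal.coe_real_pi, ENNReal.ofReal_coe_nnreal]
  rw [← cv] at up
  simp only [linMap_det, ← hκ] at up
  have hcχ : ContinuousOn χ (ball 0 1) := hχP.differentiableOn.continuousOn
  -- the polar lower bound
  have low : ENNReal.ofReal (κ * (Gf c N ρ - Gf c N δ)) ≤
      ∫⁻ z in A, ENNReal.ofReal |κ * ‖χ z / z ^ 2‖ ^ 2| := by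
    rw [← lintegral_indicator hAo.measurableSet, ← Complex.lintegral_comp_polarCoord_symm]
    have sub : Set.Ioo δ ρ ×ˢ Set.Ioo (-Real.pi) Real.pi ⊆ polarCoord.target := by
      rw [polarCoord_target]
      exact Set.prod_mono (fun t ht => hδ.trans ht.1) subset_rfl
    refine le_trans ?_ (lintegral_mono_set sub)
    have hval : ∀ t ∈ Set.Ioo δ ρ, ∀ θ : ℝ, (t : ℂ) * Complex.exp (θ * Complex.I) ∈ A := by
      intro t ht θ
      have h0 : 0 < t := hδ.trans ht.1
      simpa [hA, Complex.norm_exp_ofReal_mul_I, abs_of_pos h0] using ht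
    have eqn : ∀ p ∈ Set.Ioo δ ρ ×ˢ Set.Ioo (-Real.pi) Real.pi,
        ENNReal.ofReal p.1 • A.indicator (fun z => ENNReal.ofReal |κ * ‖χ z / z ^ 2‖ ^ 2|)
          (Complex.polarCoord.symm p)
        = ENNReal.ofReal (κ / p.1 ^ 3 * ‖χ (p.1 * Complex.exp (p.2 * Complex.I))‖ ^ 2) := by
      rintro ⟨t, θ⟩ ⟨ht, hθ⟩
      have h0 : 0 < t := hδ.trans ht.1
      have e1 : Complex.polarCoord.symm (t, θ) = (t : ℂ) * Complex.exp (θ * Complex.I) := by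
        rw [Complex.polarCoord_symm_apply, Complex.exp_mul_I, Complex.ofReal_cos, Complex.ofReal_sin]
      rw [e1, Set.indicator_of_mem (hval t ht θ), smul_eq_mul, ← ENNReal.ofReal_mul h0.le,
        abs_of_nonneg (by positivity)]
      congr 1
      simp only [norm_div, norm_pow, norm_mul, Complex.norm_exp_ofReal_mul_I, Complex.norm_real,
        Real.norm_eq_abs, abs_of_pos h0]
      field_simp
    have hms : MeasurableSet (Set.Ioo δ ρ ×ˢ Set.Ioo (-Real.pi) Real.pi) :=
      measurableSet_Ioo.prod measurableSet_Ioo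
    rw [setLIntegral_congr_fun hms eqn]
    have hcont : ContinuousOn (fun p : ℝ × ℝ => κ / p.1 ^ 3 * ‖χ (p.1 * Complex.exp (p.2 * Complex.I))‖ ^ 2)
        (Set.Ioo δ ρ ×ˢ Set.Ioo (-Real.pi) Real.pi) := by
      refine ContinuousOn.mul ?_ ?_
      · refine continuousOn_const.div (by fun_prop) ?_
        rintro ⟨t, θ⟩ ⟨ht, hθ⟩
        exact pow_ne_zero 3 (hδ.trans ht.1).ne'
      · refine (ContinuousOn.norm ?_).pow 2
        refine hcχ.comp (by fun_prop) ?_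
        rintro ⟨t, θ⟩ ⟨ht, hθ⟩
        simpa using hA1 _ (hval t ht θ)
    rw [Measure.volume_eq_prod, ← Measure.prod_restrict, lintegral_prod _ (by
      rw [Measure.prod_restrict, ← Measure.volume_eq_prod]
      exact (hcont.aemeasurable hms).ennreal_ofReal)]
    have gcont : ContinuousOn (fun t => κ * gf c N t) (Set.Icc δ ρ) := by
      unfold gf
      refine continuousOn_const.mul (continuousOn_const.mul (ContinuousOn.div (by fun_prop) (by fun_prop) ?_))
      intro t ht
      exact pow_ne_zero 3 (hδ.trans_le ht.1).ne'
    have gint : ∫ t in Set.Ioo δ ρ, κ * gf c N t = κ * (Gf c N ρ - Gf c N δ) := by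
      rw [← integral_Ioc_eq_integral_Ioo, ← intervalIntegral.integral_of_le hδρ.le,
        intervalIntegral.integral_const_mul, intervalIntegral.integral_eq_sub_of_hasDerivAt]
      · intro t ht
        rw [Set.uIcc_of_le hδρ.le] at ht
        exact Gf_deriv c N (hδ.trans_le ht.1).ne'
      · apply ContinuousOn.intervalIntegrable
        rw [Set.uIcc_of_le hδρ.le]
        have := (continuousOn_const (c := κ⁻¹)).mul gcont
        refine this.congr fun t _ => ?_
        simp only [Pi.mul_apply]
        field_simp
    rw [← gint, ofReal_integral_eq_lintegral_ofReal
      (gcont.integrableOn_Icc.mono_set Set.Ioo_subset_Icc_self)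
      (by
        refine (ae_restrict_iff' measurableSet_Ioo).2 (Eventually.of_forall fun t ht => ?_)
        have h0 : 0 < t := hδ.trans ht.1
        unfold gf
        simp only [Pi.zero_apply]
        positivity)]
    refine setLIntegral_mono' measurableSet_Ioo fun t ht => ?_
    have h0 : 0 < t := hδ.trans ht.1
    have h1 : t < 1 := ht.2.trans hρ
    have cont1 : Continuous fun θ : ℝ => κ / t ^ 3 * ‖χ (t * Complex.exp (θ * Complex.I))‖ ^ 2 := by
      refine continuous_const.mul (Continuous.pow (Continuous.norm ?_) 2)
      exact hcχ.comp_continuous (by fun_prop) fun θ => by simpa using hA1 _ (hval t ht θ)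
    have hpi : -Real.pi ≤ Real.pi := by linarith [Real.pi_pos]
    rw [← ofReal_integral_eq_lintegral_ofReal
      ((cont1.integrableOn_Icc (a := -Real.pi) (b := Real.pi)).mono_set Set.Ioo_subset_Icc_self)
      (Eventually.of_forall fun θ => by positivity)]
    apply ENNReal.ofReal_le_ofReal
    rw [← integral_Ioc_eq_integral_Ioo, ← intervalIntegral.integral_of_le hpi,
      intervalIntegral.integral_const_mul]
    have par := sum_le_hasSum (Finset.range N) (fun i _ => by positivity) (hχP.parseval h0.le h1)
    have e3 : κ * gf c N t = κ / t ^ 3 * ∑ i ∈ Finset.range N,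
        2 * Real.pi * (‖((i:ℂ) - 1) * c i‖ ^ 2 * t ^ (2 * i)) := by
      rw [← Finset.mul_sum]
      unfold gf
      have : ∀ i : ℕ, ‖((i:ℂ) - 1) * c i‖ ^ 2 = ((i:ℝ) - 1) ^ 2 * ‖c i‖ ^ 2 := by
        intro i
        rw [norm_mul, mul_pow]
        congr 1
        have : ((i:ℂ) - 1) = (((i:ℝ) - 1 : ℝ) : ℂ) := by push_cast; rfl
        rw [this, Complex.norm_real, Real.norm_eq_abs, sq_abs]
      simp only [this]
      ring
    rw [e3]
    exact mul_le_mul_of_nonneg_left par (by positivity)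
  exact (ENNReal.ofReal_le_ofReal_iff (by positivity)).1 (low.trans up)


theorem PS.tail3 {e c} (he : PS e c) (c0 : c 0 = 1) (c1 : c 1 = 0) {ρ : ℝ} (h0 : 0 < ρ) (h1 : ρ < 1) :
    ∃ K : ℝ, 0 ≤ K ∧ ∀ z : ℂ, ‖z‖ < ρ → ‖e z - 1 - c 2 * z ^ 2‖ ≤ K * ‖z‖ ^ 3 := by
  have hs : Summable (fun n => ‖c (n + 3)‖ * ρ ^ n) := by
    have := ((summable_nat_add_iff 3).2 (he.summable_norm h0.le h1)).mul_right (ρ ^ 3)⁻¹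
    refine this.congr fun n => ?_
    rw [pow_add]; field_simp
  refine ⟨∑' n, ‖c (n + 3)‖ * ρ ^ n, tsum_nonneg fun n => by positivity, fun z hz => ?_⟩
  have hz1 := he z (hz.trans h1)
  rw [← hasSum_nat_add_iff' 3] at hz1
  have e1 : e z - ∑ i ∈ Finset.range 3, c i * z ^ i = e z - 1 - c 2 * z ^ 2 := by
    simp [Finset.sum_range_succ, c0, c1]; ring
  rw [e1] at hz1
  rw [← hz1.tsum_eq]
  refine tsum_of_norm_bounded (hs.hasSum.mul_right (‖z‖ ^ 3)) fun n => ?_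
  rw [norm_mul, norm_pow, pow_add, ← mul_assoc]
  gcongr

theorem lin_bound {E z n c2 : ℂ} {K t δ : ℝ} (hK : 0 ≤ K) (hz : ‖z‖ = t) (hδ : 0 < δ) (hδt : δ < t)
    (ht : t < 1) (hE : E = 1 + c2 * z ^ 2 + n) (hn : ‖n‖ ≤ K * t ^ 3)
    (hδ1 : δ * (4 * ‖c2‖ + 2 * K + 1) ≤ 1) :
    ‖E / z - (c2 * δ ^ 2) * (starRingEnd ℂ) (E / z)‖
      < 1 / δ + (4 * K + ‖c2‖ * (‖c2‖ + K) + 1) * δ ^ 2 := by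
  have ht0 : 0 < t := hδ.trans hδt
  have hz0 : z ≠ 0 := norm_pos_iff.1 (hz ▸ ht0)
  have hcz : (starRingEnd ℂ) z ≠ 0 := by simpa using hz0
  have hzz : z * (starRingEnd ℂ) z = t ^ 2 := by rw [Complex.mul_conj', hz]
  have ht0c : (t : ℂ) ≠ 0 := by exact_mod_cast ht0.ne'
  have key : E / z - (c2 * δ ^ 2) * (starRingEnd ℂ) (E / z)
      = 1 / z + c2 * z * (((t ^ 2 - δ ^ 2) / t ^ 2 : ℝ) : ℂ) + n / z
        - (c2 * δ ^ 2) * (starRingEnd ℂ) (c2 * z + n / z) := by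
    rw [hE]
    push_cast
    rw [← hzz]
    simp only [map_div₀, map_add, map_mul, map_one, map_pow]
    field_simp
    ring
  have hnz : ‖n / z‖ ≤ K * t ^ 2 := by
    rw [norm_div, hz, div_le_iff₀ ht0]; linarith [hn]
  have hb2 : ‖c2 * z + n / z‖ ≤ ‖c2‖ + K := by
    refine (norm_add_le _ _).trans ?_
    rw [norm_mul, hz]
    have : t ^ 2 ≤ 1 := by nlinarith
    have := norm_nonneg c2
    nlinarith
  have hpos : 0 ≤ (t ^ 2 - δ ^ 2) / t ^ 2 := div_nonneg (by nlinarith) (by positivity)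
  rw [key]
  have n1 : ‖1 / z‖ = 1 / t := by rw [norm_div, hz, norm_one]
  have n2 : ‖c2 * z * (((t ^ 2 - δ ^ 2) / t ^ 2 : ℝ) : ℂ)‖ = ‖c2‖ * ((t - δ) * (t + δ) / t) := by
    rw [norm_mul, norm_mul, hz, Complex.norm_real, Real.norm_of_nonneg hpos]
    field_simp
    ring
  have n3 : ‖(c2 * δ ^ 2) * (starRingEnd ℂ) (c2 * z + n / z)‖ ≤ ‖c2‖ * (‖c2‖ + K) * δ ^ 2 := by
    rw [norm_mul, RCLike.norm_conj, norm_mul, norm_pow, Complex.norm_real, Real.norm_of_nonneg hδ.le]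
    have := mul_le_mul_of_nonneg_left hb2 (by positivity : 0 ≤ ‖c2‖ * δ ^ 2)
    linarith
  have tri : ‖1 / z + c2 * z * (((t ^ 2 - δ ^ 2) / t ^ 2 : ℝ) : ℂ) + n / z
        - (c2 * δ ^ 2) * (starRingEnd ℂ) (c2 * z + n / z)‖
      ≤ 1 / t + ‖c2‖ * ((t - δ) * (t + δ) / t) + K * t ^ 2 + ‖c2‖ * (‖c2‖ + K) * δ ^ 2 := by
    refine (norm_sub_le _ _).trans ?_
    refine add_le_add ((norm_add_le _ _).trans (add_le_add ((norm_add_le _ _).trans ?_) hnz)) n3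
    rw [n1, n2]
  refine tri.trans_lt ?_
  have hd2 : 0 < δ ^ 2 := by positivity
  have e1 : 1 / δ - 1 / t = (t - δ) / t * (1 / δ) := by field_simp
  have hA : 4 * ‖c2‖ + 2 * K + 1 ≤ 1 / δ := by rw [le_div_iff₀ hδ]; linarith
  have hc := norm_nonneg c2
  have hq : 0 ≤ (t - δ) / t := div_nonneg (by linarith) ht0.le
  have e2 : ‖c2‖ * ((t - δ) * (t + δ) / t) = (t - δ) / t * (‖c2‖ * (t + δ)) := by ring
  have hcb : ‖c2‖ * (t + δ) ≤ 2 * ‖c2‖ := by nlinarith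
  have e3 : (t - δ) / t * (‖c2‖ * (t + δ)) ≤ (t - δ) / t * (2 * ‖c2‖) :=
    mul_le_mul_of_nonneg_left hcb hq
  have e4 : (t - δ) / t * (4 * ‖c2‖ + 2 * K + 1) ≤ (t - δ) / t * (1 / δ) :=
    mul_le_mul_of_nonneg_left hA hq
  suffices K * t ^ 2 ≤ (t - δ) / t * (2 * ‖c2‖ + 2 * K + 1) + 4 * K * δ ^ 2 by
    rw [e2]; nlinarith
  rcases le_total t (2 * δ) with h | h
  · have : t ^ 2 ≤ 4 * δ ^ 2 := by nlinarith
    have := mul_le_mul_of_nonneg_left this hK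
    have : 0 ≤ (t - δ) / t * (2 * ‖c2‖ + 2 * K + 1) := by positivity
    linarith
  · have h2 : 1 / 2 ≤ (t - δ) / t := by rw [le_div_iff₀ ht0]; linarith
    have h3 : 1 / 2 * (2 * ‖c2‖ + 2 * K + 1) ≤ (t - δ) / t * (2 * ‖c2‖ + 2 * K + 1) :=
      mul_le_mul_of_nonneg_right h2 (by positivity)
    have : t ^ 2 ≤ 1 := by nlinarith
    have := mul_le_mul_of_nonneg_left this hK
    have : 0 ≤ 4 * K * δ ^ 2 := by positivity
    linarith

theorem Gf_nonpos {e c} (he : PS e c) (c0 : c 0 = 1) (c1 : c 1 = 0)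
    (hinj : Set.InjOn (fun z => e z / z) (ball 0 1 \ {0})) (N : ℕ) {ρ : ℝ} (h0 : 0 < ρ) (h1 : ρ < 1) :
    Gf c (N + 1) ρ ≤ 0 := by
  obtain ⟨K, hK, htail⟩ := he.tail3 c0 c1 h0 h1
  set C := 4 * K + ‖c 2‖ * (‖c 2‖ + K) + 1 with hC
  have hC0 : 0 ≤ C := by positivity
  set Q : ℝ → ℝ := fun δ => ∑ j ∈ Finset.range N, (j : ℝ) * ‖c (j + 1)‖ ^ 2 * δ ^ (2 * j) with hQ
  have hQ0 : Q 0 = 0 := by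
    refine Finset.sum_eq_zero fun j _ => ?_
    rcases j with _ | j <;> simp
  have hG : ∀ δ : ℝ, 0 < δ → Gf c (N + 1) δ = Real.pi * (Q δ - 1 / δ ^ 2) := by
    intro δ hδ
    unfold Gf
    rw [Finset.sum_range_succ']
    have : ∑ k ∈ Finset.range N, (((k + 1 : ℕ):ℝ) - 1) * ‖c (k + 1)‖ ^ 2 * δ ^ (2 * (k + 1)) = Q δ * δ ^ 2 := by
      rw [hQ, Finset.sum_mul]
      refine Finset.sum_congr rfl fun k _ => ?_
      push_cast; ring
    rw [this, c0]
    field_simp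
    simp
    ring
  have ev : ∀ᶠ δ in 𝓝[>] (0:ℝ), (1 - ‖c 2‖ ^ 2 * δ ^ 4) * (Gf c (N + 1) ρ - Real.pi * Q δ)
      ≤ Real.pi * (2 * C * δ + C ^ 2 * δ ^ 4 + ‖c 2‖ ^ 2 * δ ^ 2) := by
    have hpos : 0 < min ρ (1 / (4 * ‖c 2‖ + 2 * K + 1)) := lt_min h0 (by positivity)
    filter_upwards [Ioo_mem_nhdsGT hpos] with δ hδ
    have hδ0 : 0 < δ := hδ.1
    have hδρ : δ < ρ := hδ.2.trans_le (min_le_left _ _)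
    have hδ1 : δ * (4 * ‖c 2‖ + 2 * K + 1) ≤ 1 := by
      have := (hδ.2.trans_le (min_le_right _ _)).le
      rwa [le_div_iff₀ (by positivity)] at this
    have hc := norm_nonneg (c 2)
    have hkn : ‖c 2 * (δ:ℂ) ^ 2‖ = ‖c 2‖ * δ ^ 2 := by
      rw [norm_mul, norm_pow, Complex.norm_real, Real.norm_of_nonneg hδ0.le]
    have hk : ‖c 2 * (δ:ℂ) ^ 2‖ < 1 := by
      rw [hkn]
      have h2 : δ < 1 := hδρ.trans h1
      have h3 : 4 * (δ * ‖c 2‖) ≤ 1 := by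
        have := mul_nonneg hδ0.le hK
        nlinarith
      have h4 : 0 ≤ δ * ‖c 2‖ := by positivity
      nlinarith
    have := area_ineq he hinj (N + 1) hδ0 hδρ h1 hk (R := 1 / δ + C * δ ^ 2) (by positivity)
      (fun z hz1 hz2 => lin_bound hK rfl hδ0 hz1 (hz2.trans h1)
        (n := e z - 1 - c 2 * z ^ 2) (by ring) (htail z hz2) hδ1)
    rw [hkn, hG δ hδ0] at this
    have e1 : Real.pi * (1 / δ + C * δ ^ 2) ^ 2
       = Real.pi * (1 / δ ^ 2) + Real.pi * (2 * C * δ + C ^ 2 * δ ^ 4) := by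
      field_simp; ring
    have e2 : (1 - (‖c 2‖ * δ ^ 2) ^ 2) * (Gf c (N + 1) ρ - Real.pi * (Q δ - 1 / δ ^ 2))
      = (1 - ‖c 2‖ ^ 2 * δ ^ 4) * (Gf c (N + 1) ρ - Real.pi * Q δ) + Real.pi * (1 / δ ^ 2)
        - Real.pi * (‖c 2‖ ^ 2 * δ ^ 2) := by
      field_simp; ring
    rw [e1, e2] at this
    linarith
  have t1 : Tendsto (fun δ : ℝ => (1 - ‖c 2‖ ^ 2 * δ ^ 4) * (Gf c (N + 1) ρ - Real.pi * Q δ))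
      (𝓝[>] 0) (𝓝 (Gf c (N + 1) ρ)) := by
    have hc : Continuous (fun δ : ℝ => (1 - ‖c 2‖ ^ 2 * δ ^ 4) * (Gf c (N + 1) ρ - Real.pi * Q δ)) := by
      fun_prop
    have := (hc.tendsto 0).mono_left (nhdsWithin_le_nhds (s := Set.Ioi 0))
    simpa [hQ0] using this
  have t2 : Tendsto (fun δ : ℝ => Real.pi * (2 * C * δ + C ^ 2 * δ ^ 4 + ‖c 2‖ ^ 2 * δ ^ 2))
      (𝓝[>] 0) (𝓝 0) := by
    have hc : Continuous (fun δ : ℝ => Real.pi * (2 * C * δ + C ^ 2 * δ ^ 4 + ‖c 2‖ ^ 2 * δ ^ 2)) := by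
      fun_prop
    have := (hc.tendsto 0).mono_left (nhdsWithin_le_nhds (s := Set.Ioi 0))
    simpa using this
  exact le_of_tendsto_of_tendsto t1 t2 ev

theorem area_thm {e c} (he : PS e c) (c0 : c 0 = 1) (c1 : c 1 = 0)
    (hinj : Set.InjOn (fun z => e z / z) (ball 0 1 \ {0})) (N : ℕ) :
    ∑ k ∈ Finset.range (N + 1), ((k:ℝ) - 1) * ‖c k‖ ^ 2 ≤ 0 := by
  have := le_of_lt_one_limit (C := 0)
    (p := fun t => ∑ k ∈ Finset.range (N + 1), ((k:ℝ) - 1) * ‖c k‖ ^ 2 * t ^ (2 * k))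
    (by fun_prop) (by
      intro t h0 h1
      have := Gf_nonpos he c0 c1 hinj N h0 h1
      unfold Gf at this
      by_contra hcon
      push Not at hcon
      have : 0 < Real.pi * ((∑ k ∈ Finset.range (N + 1), ((k:ℝ) - 1) * ‖c k‖ ^ 2 * t ^ (2 * k)) / t ^ 2) := by
        have := Real.pi_pos
        positivity
      linarith)
  simpa using this


/-- interleave with zeros -/
def evenC (d : ℕ → ℂ) (n : ℕ) : ℂ := if n % 2 = 0 then d (n / 2) else 0

theorem evenC_even (d : ℕ → ℂ) (k : ℕ) : evenC d (2 * k) = d k := by simp [evenC]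
theorem evenC_odd (d : ℕ → ℂ) (k : ℕ) : evenC d (2 * k + 1) = 0 := by simp [evenC]

theorem PS.even {u d} (h : PS u d) : PS (fun z => u (z ^ 2)) (evenC d) := by
  intro z hz
  have hz2 : ‖z ^ 2‖ < 1 := by rw [norm_pow]; nlinarith [norm_nonneg z]
  have h1 := h (z ^ 2) hz2
  have : HasSum (fun n => evenC d n * z ^ n) (u (z ^ 2) + 0) := by
    apply HasSum.even_add_odd
    · refine h1.congr_fun fun k => ?_
      rw [evenC_even, pow_mul]
    · simp only [evenC_odd, zero_mul]; exact hasSum_zero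
  simpa using this

theorem exists_phi {f : ℂ → ℂ} {a : ℕ → ℂ}
    (hf : ∀ z ∈ Metric.ball (0 : ℂ) 1, HasSum (fun k : ℕ => a k * z ^ (2 * k + 1)) (f z)) :
    ∃ φ : ℂ → ℂ, PS φ a ∧ ∀ z : ℂ, ‖z‖ < 1 → f z = z * φ (z ^ 2) := by
  have hP : PS (fun w => ∑' k, a k * w ^ k) a := by
    intro w hw
    apply Summable.hasSum
    obtain ⟨z, hz⟩ := IsAlgClosed.exists_pow_nat_eq w (n := 2) (by norm_num)
    by_cases h0 : z = 0
    · have : w = 0 := by rw [← hz, h0]; simp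
      rw [this]
      exact summable_of_ne_finset_zero (s := {0}) (by intro b hb; simp at hb; simp [hb])
    · have hz1 : ‖z‖ < 1 := by
        rw [← hz, norm_pow] at hw
        by_contra hcon
        push Not at hcon
        nlinarith
      have := (hf z (by simpa using hz1)).summable.mul_right z⁻¹
      refine this.congr fun k => ?_
      rw [← hz, ← pow_mul, pow_succ]; field_simp
  refine ⟨_, hP, fun z hz => ?_⟩
  have hz2 : ‖z ^ 2‖ < 1 := by rw [norm_pow]; nlinarith [norm_nonneg z]
  refine (hf z (by simpa using hz)).unique (((hP _ hz2).mul_left z).congr_fun fun k => ?_)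
  rw [← pow_mul]; ring

theorem sum_range_two_mul (F : ℕ → ℝ) (N : ℕ) :
    ∑ n ∈ Finset.range (2 * N), F n = ∑ k ∈ Finset.range N, (F (2 * k) + F (2 * k + 1)) := by
  induction N with
  | zero => simp
  | succ N ih =>
    rw [show 2 * (N + 1) = 2 * N + 1 + 1 by ring, Finset.sum_range_succ, Finset.sum_range_succ, ih,
      Finset.sum_range_succ]; ring

/-- Coefficients of the reciprocal: key facts. -/
theorem exists_recip {f : ℂ → ℂ} {a : ℕ → ℂ}
    (hf : ∀ z ∈ Metric.ball (0 : ℂ) 1, HasSum (fun k : ℕ => a k * z ^ (2 * k + 1)) (f z))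
    (ha1 : a 0 = 1) (huniv : Set.InjOn f (Metric.ball (0 : ℂ) 1)) :
    ∃ d : ℕ → ℂ, d 0 = 1 ∧
      (∀ n, ∑ p ∈ Finset.HasAntidiagonal.antidiagonal (n + 1), d p.1 * a p.2 = 0) ∧
      ∀ N, ∑ k ∈ Finset.range N, (2 * (k:ℝ) + 1) * ‖d (k + 1)‖ ^ 2 ≤ 1 := by
  obtain ⟨φ, hφ, hfφ⟩ := exists_phi hf
  have hne : ∀ w : ℂ, ‖w‖ < 1 → φ w ≠ 0 := by
    intro w hw h0
    obtain ⟨z, hz⟩ := IsAlgClosed.exists_pow_nat_eq w (n := 2) (by norm_num)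
    have hz1 : ‖z‖ < 1 := by
      rw [← hz, norm_pow] at hw
      by_contra hcon
      push Not at hcon
      nlinarith
    have h1 : f z = 0 := by rw [hfφ z hz1, hz, h0, mul_zero]
    have h2 : f 0 = 0 := by rw [hfφ 0 (by simp)]; simp
    have h3 : z = 0 := huniv (by simpa using hz1) (by simp) (h1.trans h2.symm)
    rw [← hz, h3] at h0
    have := hφ.zero_eq
    simp [ha1] at this h0
    rw [this] at h0
    exact one_ne_zero h0
  have hdiff : DifferentiableOn ℂ (fun w => (φ w)⁻¹) (ball 0 1) :=
    hφ.differentiableOn.inv fun w hw => hne w (by simpa using hw)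
  obtain ⟨d, hd⟩ : ∃ d, PS (fun w => (φ w)⁻¹) d := ⟨_, PS.taylor hdiff⟩
  have hd0 : d 0 = 1 := by
    rw [← hd.zero_eq, hφ.zero_eq, ha1]; simp
  refine ⟨d, hd0, fun n => ?_, fun N => ?_⟩
  · have h1 : PS (fun _ => (1:ℂ)) (fun n => if n = 0 then 1 else 0) := by
      intro z _
      have := hasSum_single (f := fun n : ℕ => (if n = 0 then (1:ℂ) else 0) * z ^ n) 0
        (by intro b hb; simp [hb])
      simpa using this
    have h2 := (hd.mul hφ).unique (h1.congr fun z hz => by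
      simp [inv_mul_cancel₀ (hne z hz)])
    simpa using congrFun h2 (n + 1)
  · have hE := hd.even
    have hinj : Set.InjOn (fun z : ℂ => (φ (z ^ 2))⁻¹ / z) (ball 0 1 \ {0}) := by
      have key : ∀ z ∈ ball (0:ℂ) 1 \ {0}, (φ (z ^ 2))⁻¹ / z = (f z)⁻¹ := by
        intro z hz
        rw [hfφ z (by simpa using hz.1)]
        rw [mul_inv]; ring
      intro x hx y hy hxy
      simp only [key x hx, key y hy] at hxy
      exact huniv hx.1 hy.1 (inv_injective hxy)
    have := area_thm hE (by rw [show (0:ℕ) = 2 * 0 by rfl, evenC_even, hd0]) (evenC_odd d 0) hinj (2 * N + 1)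
    rw [show 2 * N + 1 + 1 = 2 * (N + 1) by ring, sum_range_two_mul] at this
    simp only [evenC_even, evenC_odd] at this
    rw [Finset.sum_range_succ'] at this
    simp only [hd0] at this
    have e : ∀ k ∈ Finset.range N, (2 * (k:ℝ) + 1) * ‖d (k + 1)‖ ^ 2
       = (((2 * (k + 1) : ℕ) : ℝ) - 1) * ‖d (k + 1)‖ ^ 2 +
        (((2 * (k + 1) + 1 : ℕ) : ℝ) - 1) * ‖(0:ℂ)‖ ^ 2 := by
      intro k _
      push_cast; simp; left; ring
    rw [Finset.sum_congr rfl e]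
    simp at this ⊢
    linarith

theorem abel_ineq (x y l : ℕ → ℝ) (hl : Antitone l) (hl0 : ∀ n, 0 ≤ l n)
    (h : ∀ n, ∑ k ∈ Finset.range n, x k ≤ ∑ k ∈ Finset.range n, y k) (N : ℕ) :
    ∑ k ∈ Finset.range N, l k * x k ≤ ∑ k ∈ Finset.range N, l k * y k := by
  have key : ∀ n, l n * ∑ k ∈ Finset.range (n + 1), (y k - x k)
      ≤ ∑ k ∈ Finset.range (n + 1), l k * (y k - x k) := by
    intro n
    induction n with
    | zero => simp
    | succ n ih =>
      rw [Finset.sum_range_succ, Finset.sum_range_succ (n := n + 1), mul_add]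
      have h1 : 0 ≤ ∑ k ∈ Finset.range (n + 1), (y k - x k) := by
        rw [Finset.sum_sub_distrib]; linarith [h (n + 1)]
      have := mul_le_mul_of_nonneg_right (hl (Nat.le_succ n)) h1
      simp only [Nat.succ_eq_add_one] at this
      linarith
  rcases N with _ | n
  · simp
  · have h1 : 0 ≤ ∑ k ∈ Finset.range (n + 1), (y k - x k) := by
      rw [Finset.sum_sub_distrib]; linarith [h (n + 1)]
    have h2 := (mul_nonneg (hl0 n) h1).trans (key n)
    simp only [mul_sub, Finset.sum_sub_distrib] at h2
    linarith

/-- `‖a_{n+1}‖² ≤ ∑_{j ≤ n} ‖a_j‖² / (2 (n-j) + 1)`. -/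
theorem coeff_rec {a d : ℕ → ℂ} (hd0 : d 0 = 1)
    (hrec : ∀ n, ∑ p ∈ Finset.HasAntidiagonal.antidiagonal (n + 1), d p.1 * a p.2 = 0)
    (hd : ∀ N, ∑ k ∈ Finset.range N, (2 * (k:ℝ) + 1) * ‖d (k + 1)‖ ^ 2 ≤ 1) (n : ℕ) :
    ‖a (n + 1)‖ ^ 2 ≤ ∑ k ∈ Finset.range (n + 1), ‖a (n - k)‖ ^ 2 / (2 * (k:ℝ) + 1) := by
  have h1 := hrec n
  rw [Finset.Nat.sum_antidiagonal_eq_sum_range_succ (fun i j => d i * a j), Finset.sum_range_succ'] at h1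
  simp only [hd0, one_mul, Nat.sub_zero, Nat.add_sub_add_right] at h1
  have h2 : a (n + 1) = - ∑ k ∈ Finset.range (n + 1), d (k + 1) * a (n - k) := by
    linear_combination h1
  have h3 : ‖a (n + 1)‖ ≤ ∑ k ∈ Finset.range (n + 1), ‖d (k + 1)‖ * ‖a (n - k)‖ := by
    rw [h2, norm_neg]
    refine (norm_sum_le _ _).trans_eq ?_
    simp
  have h4 : (∑ k ∈ Finset.range (n + 1), ‖d (k + 1)‖ * ‖a (n - k)‖) ^ 2
      ≤ (∑ k ∈ Finset.range (n + 1), (2 * (k:ℝ) + 1) * ‖d (k + 1)‖ ^ 2) *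
        ∑ k ∈ Finset.range (n + 1), ‖a (n - k)‖ ^ 2 / (2 * (k:ℝ) + 1) := by
    apply Finset.sum_sq_le_sum_mul_sum_of_sq_eq_mul
    · intro i _; positivity
    · intro i _; positivity
    · intro i _; field_simp
  have h5 : 0 ≤ ∑ k ∈ Finset.range (n + 1), ‖a (n - k)‖ ^ 2 / (2 * (k:ℝ) + 1) :=
    Finset.sum_nonneg fun i _ => by positivity
  calc ‖a (n + 1)‖ ^ 2 ≤ (∑ k ∈ Finset.range (n + 1), ‖d (k + 1)‖ * ‖a (n - k)‖) ^ 2 := by gcongr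
    _ ≤ _ := h4
    _ ≤ 1 * _ := mul_le_mul_of_nonneg_right (hd _) h5
    _ = _ := one_mul _

theorem conv_le (u v : ℕ → ℝ) (hu : ∀ n, 0 ≤ u n) (hv : ∀ n, 0 ≤ v n) (N : ℕ) :
    ∑ n ∈ Finset.range N, ∑ k ∈ Finset.range (n + 1), u k * v (n - k)
      ≤ (∑ k ∈ Finset.range N, u k) * ∑ k ∈ Finset.range N, v k := by
  have : ∑ n ∈ Finset.range N, ∑ k ∈ Finset.range (n + 1), u k * v (n - k)
      = ∑ k ∈ Finset.range N, ∑ n ∈ Finset.Ico k N, u k * v (n - k) := by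
    have := Finset.sum_Ico_Ico_comm 0 N (fun i j => u i * v (j - i))
    simp only [← Finset.range_eq_Ico] at this
    exact this.symm
  rw [this, Finset.sum_mul]
  refine Finset.sum_le_sum fun k hk => ?_
  rw [← Finset.mul_sum]
  refine mul_le_mul_of_nonneg_left ?_ (hu k)
  rw [Finset.sum_Ico_eq_sum_range]
  simp only [Nat.add_sub_cancel_left]
  exact Finset.sum_le_sum_of_subset_of_nonneg (Finset.range_mono (Nat.sub_le _ _)) fun i _ _ => hv i

theorem kappa_le (N : ℕ) :
    ∑ k ∈ Finset.range N, (25 / 81 : ℝ) ^ (k + 1) / (2 * (k:ℝ) + 1) ≤ 1064 / 3000 + 1 / 1000 := by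
  have h : ∀ k : ℕ, (25 / 81 : ℝ) ^ (k + 2) / (2 * ((k + 1 : ℕ):ℝ) + 1) ≤ (25 / 81) ^ 2 / 3 * (25 / 81) ^ k := by
    intro k
    rw [div_le_iff₀ (by positivity)]
    have : (0:ℝ) ≤ k := Nat.cast_nonneg k
    have h2 : (0:ℝ) < (25 / 81) ^ k := by positivity
    push_cast
    rw [pow_add]
    nlinarith [mul_nonneg this h2.le]
  have hg : ∀ M, ∑ k ∈ Finset.range M, (25 / 81 : ℝ) ^ k ≤ 81 / 56 := by
    intro M
    have := (hasSum_geometric_of_lt_one (r := (25 / 81 : ℝ)) (by norm_num) (by norm_num))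
    refine (sum_le_hasSum (Finset.range M) (fun i _ => by positivity) this).trans_eq (by norm_num)
  rcases N with _ | N
  · norm_num
  · rw [Finset.sum_range_succ']
    have h1 := Finset.sum_le_sum fun k (_ : k ∈ Finset.range N) => h k
    rw [← Finset.mul_sum] at h1
    have h2 := mul_le_mul_of_nonneg_left (hg N) (by norm_num : (0:ℝ) ≤ (25 / 81) ^ 2 / 3)
    have h3 := h1.trans h2
    norm_num at h3 ⊢
    linarith

theorem S_le {a d : ℕ → ℂ} (ha : a 0 = 1) (hd0 : d 0 = 1)
    (hrec : ∀ n, ∑ p ∈ Finset.HasAntidiagonal.antidiagonal (n + 1), d p.1 * a p.2 = 0)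
    (hd : ∀ N, ∑ k ∈ Finset.range N, (2 * (k:ℝ) + 1) * ‖d (k + 1)‖ ^ 2 ≤ 1) (N : ℕ) :
    ∑ n ∈ Finset.range N, (25 / 81 : ℝ) ^ n * ‖a n‖ ^ 2 ≤ 156 / 100 := by
  rcases N with _ | N
  · norm_num
  set S := ∑ n ∈ Finset.range (N + 1), (25 / 81 : ℝ) ^ n * ‖a n‖ ^ 2 with hS
  have hS0 : 0 ≤ S := Finset.sum_nonneg fun i _ => by positivity
  have h1 : S ≤ 1 + (1064 / 3000 + 1 / 1000) * S := by
    have e : S = ∑ n ∈ Finset.range N, (25 / 81 : ℝ) ^ (n + 1) * ‖a (n + 1)‖ ^ 2 + 1 := by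
      rw [hS, Finset.sum_range_succ', ha]; simp
    have h2 : ∑ n ∈ Finset.range N, (25 / 81 : ℝ) ^ (n + 1) * ‖a (n + 1)‖ ^ 2
      ≤ ∑ n ∈ Finset.range N, ∑ k ∈ Finset.range (n + 1), ((25 / 81 : ℝ) ^ (k + 1) / (2 * (k:ℝ) + 1)) *
        ((25 / 81 : ℝ) ^ (n - k) * ‖a (n - k)‖ ^ 2) := by
      refine Finset.sum_le_sum fun n _ => ?_
      have := mul_le_mul_of_nonneg_left (coeff_rec hd0 hrec hd n)
        (by positivity : (0:ℝ) ≤ (25 / 81) ^ (n + 1))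
      refine this.trans_eq ?_
      rw [Finset.mul_sum]
      refine Finset.sum_congr rfl fun k hk => ?_
      have hk' : k ≤ n := by have := Finset.mem_range.1 hk; omega
      have : (25 / 81 : ℝ) ^ (n + 1) = (25 / 81) ^ (k + 1) * (25 / 81) ^ (n - k) := by
        rw [← pow_add]; congr 1; omega
      rw [this]; ring
    have h3 := conv_le (fun k => (25 / 81 : ℝ) ^ (k + 1) / (2 * (k:ℝ) + 1))
      (fun n => (25 / 81 : ℝ) ^ n * ‖a n‖ ^ 2) (fun n => by positivity) (fun n => by positivity) N
    have h4 : ∑ n ∈ Finset.range N, (25 / 81 : ℝ) ^ n * ‖a n‖ ^ 2 ≤ S :=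
      Finset.sum_le_sum_of_subset_of_nonneg (Finset.range_mono (Nat.le_succ N)) fun i _ _ => by positivity
    have h5 : (∑ k ∈ Finset.range N, (25 / 81 : ℝ) ^ (k + 1) / (2 * (k:ℝ) + 1)) *
        ∑ n ∈ Finset.range N, (25 / 81 : ℝ) ^ n * ‖a n‖ ^ 2 ≤ (1064 / 3000 + 1 / 1000) * S :=
      mul_le_mul (kappa_le N) h4 (Finset.sum_nonneg fun i _ => by positivity) (by norm_num)
    linarith
  linarith

theorem rs_le {rs : ℝ}
    (hmin : ∀ x : ℝ, 0 < x → x ^ 2 = (1 - x) ^ 2 * (1 + x) → rs ≤ x) : rs ≤ 5 / 9 := by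
  have hc : ContinuousOn (fun x : ℝ => x ^ 2 - (1 - x) ^ 2 * (1 + x)) (Set.Icc 0 (5 / 9)) := by fun_prop
  have := intermediate_value_Icc (by norm_num : (0:ℝ) ≤ 5 / 9) hc
  obtain ⟨x, hx, hx0⟩ := this (show (0:ℝ) ∈ _ by constructor <;> norm_num)
  simp only at hx0
  have hxp : 0 < x := by
    rcases hx.1.eq_or_lt with h | h
    · rw [← h] at hx0; norm_num at hx0
    · exact h
  exact (hmin x hxp (by linarith)).trans hx.2

theorem bohr_subordinate_odd_univalent (f g : ℂ → ℂ) (a : ℕ → ℂ) (b : ℕ → ℂ)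
    (hf : ∀ z ∈ Metric.ball (0 : ℂ) 1, HasSum (fun k : ℕ => a k * z ^ (2 * k + 1)) (f z))
    (ha1 : a 0 = 1)
    (huniv : Set.InjOn f (Metric.ball (0 : ℂ) 1))
    (hg : ∀ z ∈ Metric.ball (0 : ℂ) 1, HasSum (fun n : ℕ => b n * z ^ (n + 1)) (g z))
    (hsub : ∃ w : ℂ → ℂ, AnalyticOn ℂ w (Metric.ball (0 : ℂ) 1) ∧ w 0 = 0 ∧
      (∀ z ∈ Metric.ball (0 : ℂ) 1, w z ∈ Metric.ball (0 : ℂ) 1) ∧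
      (∀ z ∈ Metric.ball (0 : ℂ) 1, g z = f (w z)))
    (rs : ℝ) (hrs : 0 < rs) (hroot : rs ^ 2 = (1 - rs) ^ 2 * (1 + rs))
    (hmin : ∀ x : ℝ, 0 < x → x ^ 2 = (1 - x) ^ 2 * (1 + x) → rs ≤ x) :
    ∀ r : ℝ, 0 ≤ r → r ≤ rs → ∑' n : ℕ, ‖b n‖ * r ^ (n + 1) ≤ 1 := by
  intro r hr0 hr
  have hr59 : r ≤ 5 / 9 := hr.trans (rs_le hmin)
  obtain ⟨w, hwa, hw0, hwm, hgw⟩ := hsub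
  obtain ⟨d, hd0, hrec, hd⟩ := exists_recip hf ha1 huniv
  obtain ⟨φ, hφ, hfφ⟩ := exists_phi hf
  have hfP : PS f (shiftC 0 (evenC a)) :=
    (hφ.even.shift 0).congr fun z hz => by rw [hfφ z hz]; simp
  have hgP : PS (fun z => f (w z)) (shiftC 0 b) := by
    intro z hz
    have hz' : z ∈ ball (0:ℂ) 1 := by simpa using hz
    show HasSum (fun n => shiftC 0 b n * z ^ n) (f (w z))
    rw [← hgw z hz', ← hasSum_nat_add_iff' 1]
    simpa [shiftC] using hg z hz'
  have hrog : ∀ N, ∑ k ∈ Finset.range N, (‖b (2 * k)‖ ^ 2 + ‖b (2 * k + 1)‖ ^ 2)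
      ≤ ∑ k ∈ Finset.range N, ‖a k‖ ^ 2 := by
    intro N
    have := rogosinski hwa.differentiableOn hw0
      (fun z hz => by simpa using hwm z (by simpa using hz)) (2 * N + 1) f _ _ hfP hgP
    rw [Finset.sum_range_succ', Finset.sum_range_succ'] at this
    simp only [shiftC] at this
    rw [sum_range_two_mul (fun n => ‖b n‖ ^ 2), sum_range_two_mul (fun n => ‖evenC a n‖ ^ 2)] at this
    simpa [evenC_even, evenC_odd] using this
  have hS : ∀ N, ∑ k ∈ Finset.range N, (25 / 81 : ℝ) ^ k * (‖b (2 * k)‖ ^ 2 + ‖b (2 * k + 1)‖ ^ 2)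
      ≤ 156 / 100 := fun N =>
    (abel_ineq _ _ (fun k => (25 / 81 : ℝ) ^ k)
      (pow_right_anti₀ (by norm_num) (by norm_num)) (fun n => by positivity) hrog N).trans
      (S_le ha1 hd0 hrec hd N)
  have hg : ∀ M, ∑ k ∈ Finset.range M, (25 / 81 : ℝ) ^ k ≤ 81 / 56 := by
    intro M
    have := (hasSum_geometric_of_lt_one (r := (25 / 81 : ℝ)) (by norm_num) (by norm_num))
    refine (sum_le_hasSum (Finset.range M) (fun i _ => by positivity) this).trans_eq (by norm_num)
  apply Real.tsum_le_of_sum_range_le (fun n => by positivity)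
  intro n
  calc ∑ i ∈ Finset.range n, ‖b i‖ * r ^ (i + 1)
      ≤ ∑ i ∈ Finset.range (2 * n), ‖b i‖ * r ^ (i + 1) :=
        Finset.sum_le_sum_of_subset_of_nonneg (Finset.range_mono (by omega)) fun i _ _ => by positivity
    _ ≤ ∑ i ∈ Finset.range (2 * n), ‖b i‖ * (5 / 9 : ℝ) ^ (i + 1) :=
        Finset.sum_le_sum fun i _ => by gcongr
    _ = ∑ k ∈ Finset.range n, (‖b (2 * k)‖ * (5 / 9 : ℝ) ^ (2 * k + 1)
          + ‖b (2 * k + 1)‖ * (5 / 9 : ℝ) ^ (2 * k + 1 + 1)) := sum_range_two_mul _ n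
    _ ≤ ∑ k ∈ Finset.range n, (3 / 10 * ((25 / 81 : ℝ) ^ k * (‖b (2 * k)‖ ^ 2 + ‖b (2 * k + 1)‖ ^ 2))
          + 5 / 6 * (25 / 81 * (1 + 25 / 81)) * (25 / 81 : ℝ) ^ k) := by
        refine Finset.sum_le_sum fun k _ => ?_
        have e1 : (5 / 9 : ℝ) ^ (2 * k + 1) = 5 / 9 * (25 / 81) ^ k := by
          rw [pow_succ, pow_mul]; norm_num; ring
        have e2 : (5 / 9 : ℝ) ^ (2 * k + 1 + 1) = 25 / 81 * (25 / 81) ^ k := by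
          rw [pow_succ, e1]; ring
        rw [e1, e2]
        have hp : (0:ℝ) ≤ (25 / 81) ^ k := by positivity
        generalize (25 / 81 : ℝ) ^ k = q at *
        generalize ‖b (2 * k)‖ = x
        generalize ‖b (2 * k + 1)‖ = y
        nlinarith [mul_nonneg hp (sq_nonneg (3 * x / 5 - 5 / 9)), mul_nonneg hp (sq_nonneg (3 * y / 5 - 25 / 81))]
    _ ≤ 1 := by
        rw [Finset.sum_add_distrib, ← Finset.mul_sum, ← Finset.mul_sum]
        have h1 := hS n
        have h2 := hg n
        nlinarith
end

section
/- Let p be a positive integer, 0 < R ≤ 1, and let g(z) = ∑_{k≥0} b_k z^k be analytic in the unit disk 𝔻 with |g(z)| ≤ 1 for all z ∈ 𝔻. Then ∑_{k≥1} |b_k|^2 R^{pk} ≤ R^p (1 − |b_0|^2)^2 / (1 − |b_0|^2 R^p). -/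
open Complex MeasureTheory in
lemma aux_parseval (c : ℕ → ℂ) (hc : Summable fun k => ‖c k‖) :
    ∃ F : C(UnitAddCircle, ℂ), (∀ x, HasSum (fun k => c k * (fourier 1 x) ^ k) (F x)) ∧
      HasSum (fun k => ‖c k‖ ^ 2)
        (‖ContinuousMap.toLp (E := ℂ) 2 (AddCircle.haarAddCircle (T := 1)) ℂ F‖ ^ 2) := by
  have hs : Summable (fun k : ℕ => c k • (fourier (k : ℤ) : C(UnitAddCircle, ℂ))) := by
    refine Summable.of_norm ?_
    simpa [norm_smul, fourier_norm] using hc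
  obtain ⟨F, hF⟩ := hs
  refine ⟨F, fun x => ?_, ?_⟩
  · have h := hF.mapL (ContinuousMap.evalCLM ℂ x)
    have hp : ∀ k : ℕ, (fourier (k : ℤ) x : ℂ) = (fourier 1 x) ^ k := by
      intro k
      induction k with
      | zero => simp
      | succ n ih => rw [Nat.cast_succ, fourier_add, ih, pow_succ]
    simp only [ContinuousMap.evalCLM_apply, ContinuousMap.smul_apply, hp, smul_eq_mul] at h
    exact h
  · set L := ContinuousMap.toLp (E := ℂ) 2 (AddCircle.haarAddCircle (T := 1)) ℂ with hL
    have h := hF.mapL L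
    simp only [map_smul] at h
    have ho := orthonormal_iff_ite.mp (orthonormal_fourier (T := 1))
    have hl : ∀ n : ℤ, L (fourier n) = fourierLp 2 n := fun n => rfl
    simp only [hl] at h
    have h1 : ∀ j : ℕ, inner ℂ (fourierLp (T := 1) 2 (j : ℤ)) (L F) = c j := by
      intro j
      have h2 := h.mapL (innerSL ℂ (fourierLp (T := 1) 2 (j : ℤ)))
      simp only [innerSL_apply_apply, inner_smul_right, ho] at h2
      have e : ∀ k : ℕ, (c k * if (j : ℤ) = (k : ℤ) then (1 : ℂ) else 0)
          = if k = j then c j else 0 := by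
        intro k
        by_cases hk : k = j
        · simp [hk]
        · simp [hk, Ne.symm hk]
      simp only [e] at h2
      exact h2.unique (hasSum_ite_eq j (c j))
    have h3 := h.mapL (innerSL ℂ (L F))
    simp only [innerSL_apply_apply, inner_smul_right] at h3
    have h4 : ∀ j : ℕ, inner ℂ (L F) (fourierLp (T := 1) 2 (j : ℤ)) = (starRingEnd ℂ) (c j) := by
      intro j; rw [← h1 j, inner_conj_symm]
    simp only [h4, Complex.mul_conj', inner_self_eq_norm_sq_to_K] at h3
    have h5 := h3.mapL Complex.reCLM
    have e1 : ∀ x : ℝ, Complex.reCLM ((x : ℂ) ^ 2) = x ^ 2 := by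
      intro x; rw [← Complex.ofReal_pow]; exact Complex.ofReal_re _
    simp only [e1] at h5
    have e2 := e1 ‖L F‖
    exact e2 ▸ h5

open Complex MeasureTheory in
lemma aux_l2 (c d : ℕ → ℂ) (f h : ℂ → ℂ) (hc : Summable fun k => ‖c k‖)
    (hd : Summable fun k => ‖d k‖)
    (hf : ∀ w : ℂ, ‖w‖ = 1 → HasSum (fun k => c k * w ^ k) (f w))
    (hh : ∀ w : ℂ, ‖w‖ = 1 → HasSum (fun k => d k * w ^ k) (h w))
    (hle : ∀ w : ℂ, ‖w‖ = 1 → ‖f w‖ ≤ ‖h w‖) :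
    ∃ A B : ℝ, HasSum (fun k => ‖c k‖ ^ 2) A ∧ HasSum (fun k => ‖d k‖ ^ 2) B ∧ A ≤ B := by
  obtain ⟨F, hF, hFs⟩ := aux_parseval c hc
  obtain ⟨H, hH, hHs⟩ := aux_parseval d hd
  refine ⟨_, _, hFs, hHs, ?_⟩
  gcongr
  refine Lp.norm_le_norm_of_ae_le ?_
  filter_upwards [ContinuousMap.coeFn_toLp (p := 2) (𝕜 := ℂ) (AddCircle.haarAddCircle (T := 1)) F,
    ContinuousMap.coeFn_toLp (p := 2) (𝕜 := ℂ) (AddCircle.haarAddCircle (T := 1)) H] with x h1 h2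
  rw [h1, h2]
  have hw : ‖(fourier 1 x : ℂ)‖ = 1 := by rw [fourier_one]; exact Circle.norm_coe _
  rw [(hF x).unique (hf _ hw), (hH x).unique (hh _ hw)]
  exact hle _ hw

lemma aux_summable (g : ℂ → ℂ) (b : ℕ → ℂ)
    (hg : ∀ z ∈ Metric.ball (0 : ℂ) 1, HasSum (fun k : ℕ => b k * z ^ k) (g z))
    (r : ℝ) (h0 : 0 ≤ r) (h1 : r < 1) : Summable fun k => ‖b k‖ * r ^ k := by
  have := (hg (r : ℂ) (by simpa [abs_of_nonneg h0] using h1)).summable.norm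
  simpa [abs_of_nonneg h0] using this

lemma aux_diff (g : ℂ → ℂ) (b : ℕ → ℂ)
    (hg : ∀ z ∈ Metric.ball (0 : ℂ) 1, HasSum (fun k : ℕ => b k * z ^ k) (g z)) :
    DifferentiableOn ℂ g (Metric.ball 0 1) := by
  intro z hz
  have hz' : ‖z‖ < 1 := by simpa using hz
  obtain ⟨r, hr, hr1⟩ := exists_between hz'
  have h := Complex.differentiableOn_tsum_of_summable_norm
    (F := fun k w => b k * w ^ k) (U := Metric.ball 0 r)
    (aux_summable g b hg r ((norm_nonneg z).trans hr.le) hr1)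
    (fun k => by fun_prop) Metric.isOpen_ball (by
      intro k w hw
      have : ‖w‖ < r := by simpa using hw
      rw [norm_mul, norm_pow]
      gcongr)
  have hzr : z ∈ Metric.ball (0 : ℂ) r := by simpa using hr
  have h2 := (h z hzr).differentiableAt (Metric.isOpen_ball.mem_nhds hzr)
  refine (h2.congr_of_eventuallyEq ?_).differentiableWithinAt
  filter_upwards [Metric.isOpen_ball.mem_nhds hz] with w hw
  exact (hg w hw).tsum_eq.symm

open ComplexConjugate in
lemma aux_pick_alg (u v : ℂ) (hu : ‖u‖ ≤ 1) (hv : ‖v‖ ≤ 1) : ‖v - u‖ ≤ ‖1 - conj u * v‖ := by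
  have h1 : ‖v - u‖ ^ 2 = ‖v‖ ^ 2 + ‖u‖ ^ 2 - 2 * (u.re * v.re + u.im * v.im) := by
    simp only [← Complex.normSq_eq_norm_sq, Complex.normSq_apply, Complex.sub_re, Complex.sub_im]
    ring
  have h2 : ‖1 - conj u * v‖ ^ 2
      = 1 + ‖u‖ ^ 2 * ‖v‖ ^ 2 - 2 * (u.re * v.re + u.im * v.im) := by
    simp [← Complex.normSq_eq_norm_sq, Complex.normSq_apply]
    ring
  refine le_of_sq_le_sq ?_ (norm_nonneg _)
  have hu2 : ‖u‖ ^ 2 ≤ 1 := pow_le_one₀ (norm_nonneg _) hu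
  have hv2 : ‖v‖ ^ 2 ≤ 1 := pow_le_one₀ (norm_nonneg _) hv
  nlinarith

open ComplexConjugate in
lemma aux_pick_strict (g : ℂ → ℂ) (hd : DifferentiableOn ℂ g (Metric.ball 0 1))
    (hb : ∀ z ∈ Metric.ball (0 : ℂ) 1, ‖g z‖ < 1) (z : ℂ) (hz : ‖z‖ < 1) :
    ‖g z - g 0‖ ≤ ‖z‖ * ‖1 - conj (g 0) * g z‖ := by
  have h0 := hb 0 (by simp)
  have hne : ∀ w ∈ Metric.ball (0 : ℂ) 1, 1 - conj (g 0) * g w ≠ 0 := by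
    intro w hw h
    have h3 : ‖conj (g 0) * g w‖ = 1 := by rw [← sub_eq_zero.mp h]; simp
    rw [norm_mul, RCLike.norm_conj] at h3
    nlinarith [hb w hw, norm_nonneg (g 0), norm_nonneg (g w)]
  have hS := Complex.norm_le_norm_of_mapsTo_ball (R := 1) (z := z)
    (f := fun w => (g w - g 0) / (1 - conj (g 0) * g w))
    ((hd.sub_const _).fun_div ((hd.const_mul _).const_sub _) hne) (by
      intro w hw
      simp only [Metric.mem_closedBall, dist_zero_right, norm_div]
      exact div_le_one_of_le₀ (aux_pick_alg _ _ h0.le (hb w hw).le) (norm_nonneg _))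
    (by simp) hz
  rw [norm_div, div_le_iff₀ (norm_pos_iff.mpr (hne z (by simpa using hz)))] at hS
  exact hS

open ComplexConjugate in
lemma aux_pick (g : ℂ → ℂ) (hd : DifferentiableOn ℂ g (Metric.ball 0 1))
    (hb : ∀ z ∈ Metric.ball (0 : ℂ) 1, ‖g z‖ ≤ 1) (z : ℂ) (hz : ‖z‖ < 1) :
    ‖g z - g 0‖ ≤ ‖z‖ * ‖1 - conj (g 0) * g z‖ := by
  have hc1 : ContinuousWithinAt (fun t : ℝ => ‖(t : ℂ) * g z - t * g 0‖) (Set.Iio 1) 1 := by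
    apply Continuous.continuousWithinAt; fun_prop
  have hc2 : ContinuousWithinAt
      (fun t : ℝ => ‖z‖ * ‖1 - (t * conj (g 0)) * (t * g z)‖) (Set.Iio 1) 1 := by
    apply Continuous.continuousWithinAt; fun_prop
  have h := le_of_tendsto_of_tendsto hc1.tendsto hc2.tendsto (by
    filter_upwards [Ioo_mem_nhdsLT (show (0 : ℝ) < 1 by norm_num)] with t ht
    have := aux_pick_strict (fun w => (t : ℂ) * g w) (hd.const_mul _) (by
      intro w hw
      rw [norm_mul, Complex.norm_real, Real.norm_of_nonneg ht.1.le]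
      nlinarith [hb w hw, ht.1, ht.2, norm_nonneg (g w)]) z hz
    simpa using this)
  simpa using h

open ComplexConjugate in
lemma aux_main (g : ℂ → ℂ) (b : ℕ → ℂ)
    (hg : ∀ z ∈ Metric.ball (0 : ℂ) 1, HasSum (fun k : ℕ => b k * z ^ k) (g z))
    (hb : ∀ z ∈ Metric.ball (0 : ℂ) 1, ‖g z‖ ≤ 1) (r : ℝ) (h0 : 0 ≤ r) (h1 : r < 1) (N : ℕ) :
    (1 - ‖b 0‖ ^ 2 * r ^ 2) * ∑ k ∈ Finset.range N, ‖b (k + 1)‖ ^ 2 * (r ^ 2) ^ (k + 1)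
      ≤ r ^ 2 * (1 - ‖b 0‖ ^ 2) ^ 2 := by
  have hg0 : g 0 = b 0 := by
    refine (hg 0 (by simp)).unique ?_
    convert hasSum_ite_eq 0 (b 0) using 2 with k
    by_cases hk : k = 0 <;> simp [hk]
  have ha : ‖b 0‖ ≤ 1 := hg0 ▸ hb 0 (by simp)
  have hs := aux_summable g b hg r h0 h1
  have hI : ∀ x : ℂ, HasSum (fun k : ℕ => if k = 0 then x else 0) x := fun x => hasSum_ite_eq 0 x
  have hIs : ∀ x : ℂ, Summable (fun k : ℕ => ‖if k = 0 then x else 0‖) := fun x => (hI x).summable.norm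
  have hs' : Summable (fun k => ‖b k * (r : ℂ) ^ k‖) := by
    simpa [abs_of_nonneg h0] using hs
  have hball : ∀ w : ℂ, ‖w‖ = 1 → ‖(r : ℂ) * w‖ = r := by
    intro w hw; simp [hw, abs_of_nonneg h0]
  have hgw : ∀ w : ℂ, ‖w‖ = 1 → HasSum (fun k => b k * (r : ℂ) ^ k * w ^ k) (g (r * w)) := by
    intro w hw
    have := hg (r * w) (by rw [mem_ball_zero_iff, hball w hw]; exact h1)
    simpa [mul_pow, mul_assoc] using this
  obtain ⟨A, B, hA, hB, hAB⟩ := aux_l2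
    (fun k => b k * (r : ℂ) ^ k - if k = 0 then b 0 else 0)
    (fun k => (r : ℂ) * ((if k = 0 then 1 else 0) - conj (b 0) * (b k * (r : ℂ) ^ k)))
    (fun w => g (r * w) - g 0) (fun w => r * (1 - conj (g 0) * g (r * w)))
    ((hs'.of_norm.sub (hI _).summable).norm)
    ((((hI _).summable.sub (hs'.of_norm.mul_left _)).mul_left _).norm)
    (by
      intro w hw
      rw [hg0]
      refine ((hgw w hw).sub (hI (b 0))).congr_fun ?_
      intro k
      by_cases hk : k = 0 <;> simp [hk])
    (by
      intro w hw
      rw [hg0]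
      refine (((hI 1).sub ((hgw w hw).mul_left (conj (b 0)))).mul_left (r : ℂ)).congr_fun ?_
      intro k
      by_cases hk : k = 0 
      · simp [hk]
      · simp [hk]; ring)
    (by
      intro w hw
      have := aux_pick g (aux_diff g b hg) hb (r * w) (by rw [hball w hw]; exact h1)
      rw [hball w hw] at this
      simpa [abs_of_nonneg h0] using this)
  rw [← hasSum_nat_add_iff' 1] at hA hB
  have hA' : HasSum (fun k => ‖b (k + 1)‖ ^ 2 * (r ^ 2) ^ (k + 1)) A := by
    have e1 : ∀ k, ‖b (k + 1)‖ ^ 2 * (r ^ 2) ^ (k + 1) =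
        ‖b (k + 1) * (r : ℂ) ^ (k + 1) - if k + 1 = 0 then b 0 else 0‖ ^ 2 := by
      intro k
      simp [abs_of_nonneg h0, mul_pow, ← pow_mul, mul_comm]
    simp only [e1]
    simpa only [Finset.range_one, Finset.sum_singleton, pow_zero, mul_one, if_true, sub_self,
      norm_zero, ne_eq, OfNat.ofNat_ne_zero, not_false_eq_true, zero_pow, sub_zero] using hA
  have hB' : HasSum (fun k => r ^ 2 * ‖b 0‖ ^ 2 * (‖b (k + 1)‖ ^ 2 * (r ^ 2) ^ (k + 1)))
      (B - r ^ 2 * (1 - ‖b 0‖ ^ 2) ^ 2) := by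
    have e1 : ∀ k, r ^ 2 * ‖b 0‖ ^ 2 * (‖b (k + 1)‖ ^ 2 * (r ^ 2) ^ (k + 1)) =
        ‖(r : ℂ) * ((if k + 1 = 0 then 1 else 0) -
          conj (b 0) * (b (k + 1) * (r : ℂ) ^ (k + 1)))‖ ^ 2 := by
      intro k
      simp [abs_of_nonneg h0, mul_pow, ← pow_mul]
      ring
    have e2 : (1 : ℂ) - conj (b 0) * b 0 = ((1 - ‖b 0‖ ^ 2 : ℝ) : ℂ) := by
      rw [Complex.conj_mul']; push_cast; ring
    have e3 : ‖(r : ℂ) * (1 - conj (b 0) * b 0)‖ ^ 2 = r ^ 2 * (1 - ‖b 0‖ ^ 2) ^ 2 := by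
      rw [e2, norm_mul, Complex.norm_real, Complex.norm_real, mul_pow, Real.norm_eq_abs,
        Real.norm_eq_abs, sq_abs, sq_abs]
    simp only [e1]
    simpa only [Finset.range_one, Finset.sum_singleton, pow_zero, mul_one, if_true, e3] using hB
  have hEq := hB'.unique (hA'.mul_left _)
  have hle := sum_le_hasSum (Finset.range N) (fun k _ => by positivity) hA'
  have hr2 : r ^ 2 ≤ 1 := pow_le_one₀ h0 h1.le
  have ha2 : ‖b 0‖ ^ 2 ≤ 1 := pow_le_one₀ (norm_nonneg _) ha
  have hpos : 0 ≤ 1 - ‖b 0‖ ^ 2 * r ^ 2 := by nlinarith [sq_nonneg r, sq_nonneg ‖b 0‖]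
  nlinarith [mul_le_mul_of_nonneg_left hle hpos]


/-- If `g(z) = ∑_{k≥0} b_k z^k` is analytic in 𝔻 with `|g| ≤ 1` there, `p ≥ 1` and
`0 < R ≤ 1`, then `∑_{k≥1} |b_k|² R^{pk} ≤ R^p (1-|b_0|²)² / (1 - |b_0|² R^p)`. -/
theorem coefficient_square_sum_bound (p : ℕ) (hp : 0 < p) (R : ℝ) (hR0 : 0 < R) (hR1 : R ≤ 1)
    (g : ℂ → ℂ) (b : ℕ → ℂ)
    (hg : ∀ z ∈ Metric.ball (0 : ℂ) 1, HasSum (fun k : ℕ => b k * z ^ k) (g z))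
    (hb : ∀ z ∈ Metric.ball (0 : ℂ) 1, ‖g z‖ ≤ 1) :
    ∑' k : ℕ, ‖b (k + 1)‖ ^ 2 * R ^ (p * (k + 1)) ≤
      R ^ p * (1 - ‖b 0‖ ^ 2) ^ 2 / (1 - ‖b 0‖ ^ 2 * R ^ p) := by
  have key : ∀ ρ : ℝ, 0 ≤ ρ → ρ < 1 → ∀ N : ℕ,
      (1 - ‖b 0‖ ^ 2 * ρ) * ∑ k ∈ Finset.range N, ‖b (k + 1)‖ ^ 2 * ρ ^ (k + 1)
      ≤ ρ * (1 - ‖b 0‖ ^ 2) ^ 2 := by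
    intro ρ h0 h1 N
    have := aux_main g b hg hb (Real.sqrt ρ) (Real.sqrt_nonneg _)
      (by rw [Real.sqrt_lt' one_pos]; simpa using h1) N
    rwa [Real.sq_sqrt h0] at this
  have key1 : ∀ ρ : ℝ, 0 ≤ ρ → ρ ≤ 1 → ∀ N : ℕ,
      (1 - ‖b 0‖ ^ 2 * ρ) * ∑ k ∈ Finset.range N, ‖b (k + 1)‖ ^ 2 * ρ ^ (k + 1)
      ≤ ρ * (1 - ‖b 0‖ ^ 2) ^ 2 := by
    intro ρ h0 h1 N
    rcases h1.lt_or_eq with h | rfl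
    · exact key ρ h0 h N
    have hc1 : ContinuousWithinAt (fun ρ : ℝ => (1 - ‖b 0‖ ^ 2 * ρ) *
        ∑ k ∈ Finset.range N, ‖b (k + 1)‖ ^ 2 * ρ ^ (k + 1)) (Set.Iio 1) 1 := by
      apply Continuous.continuousWithinAt; fun_prop
    have hc2 : ContinuousWithinAt (fun ρ : ℝ => ρ * (1 - ‖b 0‖ ^ 2) ^ 2) (Set.Iio 1) 1 := by
      apply Continuous.continuousWithinAt; fun_prop
    refine le_of_tendsto_of_tendsto hc1.tendsto hc2.tendsto ?_
    filter_upwards [Ioo_mem_nhdsLT (show (0 : ℝ) < 1 by norm_num)] with t ht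
    exact key t ht.1.le ht.2 N
  have ha : ‖b 0‖ ≤ 1 := by
    have hg0 : g 0 = b 0 := by
      refine (hg 0 (by simp)).unique ?_
      convert hasSum_ite_eq 0 (b 0) using 2 with k
      by_cases hk : k = 0 <;> simp [hk]
    exact hg0 ▸ hb 0 (by simp)
  have ha2 : ‖b 0‖ ^ 2 ≤ 1 := pow_le_one₀ (norm_nonneg _) ha
  have hρ0 : 0 < R ^ p := by positivity
  have hρ1 : R ^ p ≤ 1 := pow_le_one₀ hR0.le hR1
  have hpos : 0 ≤ 1 - ‖b 0‖ ^ 2 * R ^ p := by nlinarith [sq_nonneg ‖b 0‖]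
  simp only [pow_mul]
  rcases ha2.lt_or_eq with hlt | heq
  · have hpos' : 0 < 1 - ‖b 0‖ ^ 2 * R ^ p := by nlinarith [sq_nonneg ‖b 0‖]
    refine Real.tsum_le_of_sum_range_le (fun k => by positivity) (fun N => ?_)
    rw [le_div_iff₀ hpos', mul_comm]
    exact key1 _ hρ0.le hρ1 N
  · have hz : ∀ k, ‖b (k + 1)‖ ^ 2 = 0 := by
      intro k
      have h := key (1 / 2) (by norm_num) (by norm_num) (k + 1)
      rw [heq] at h
      have h5 := Finset.single_le_sum
        (f := fun k => ‖b (k + 1)‖ ^ 2 * (1 / 2 : ℝ) ^ (k + 1))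
        (fun i _ => by positivity) (Finset.self_mem_range_succ k)
      have h6 : ‖b (k + 1)‖ ^ 2 * (1 / 2 : ℝ) ^ (k + 1) ≤ 0 := by
        linarith
      have h7 : (0 : ℝ) < (1 / 2 : ℝ) ^ (k + 1) := by positivity
      exact le_antisymm (nonpos_of_mul_nonpos_left h6 h7) (sq_nonneg _)
    simp [hz, heq]
end

section
/- Let p be a positive integer and let f(z) = ∑_{k≥0} a_{pk+1} z^{pk+1} be a p-symmetric analytic function in 𝔻 with |f(z)| ≤ 1 in 𝔻, and write a = |a_1|. If 0 < r < 1 and a ≥ r^p, then ∑_{k≥0} |a_{pk+1}| r^{pk+1} ≤ r ( a + r^p (1 − a^2)/(1 − r^p a) ). -/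
open Filter Topology in
theorem aux_parseval_s8 {H : Type*} [NormedAddCommGroup H] [InnerProductSpace ℂ H] (e : ℕ → H)
    (he : Orthonormal ℂ e) (c : ℕ → ℂ) (x : H) (h : HasSum (fun k => c k • e k) x) :
    HasSum (fun k => ‖c k‖ ^ 2) (‖x‖ ^ 2) := by
  have h1 : Tendsto (fun s : Finset ℕ => ‖∑ k ∈ s, c k • e k‖ ^ 2) atTop (𝓝 (‖x‖ ^ 2)) :=
    (Filter.Tendsto.norm h).pow 2
  refine h1.congr fun s => ?_
  have h2 := he.inner_sum c c s
  have h3 := inner_self_eq_norm_sq (𝕜 := ℂ) (∑ k ∈ s, c k • e k)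
  rw [← h3, h2, map_sum]
  refine Finset.sum_congr rfl fun k _ => ?_
  rw [mul_comm, Complex.mul_conj, Complex.normSq_eq_norm_sq]
  simp [← Complex.ofReal_pow]

theorem aux_L2 (c d : ℕ → ℂ) (hc : Summable fun k => ‖c k‖) (hd : Summable fun k => ‖d k‖)
    (C : ℝ) (hC : 0 ≤ C)
    (h : ∀ u : ℂ, ‖u‖ = 1 → ‖∑' k, c k * u ^ k‖ ≤ C * ‖∑' k, d k * u ^ k‖) :
    Summable (fun k => ‖c k‖ ^ 2) ∧ Summable (fun k => ‖d k‖ ^ 2) ∧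
    ∑' k, ‖c k‖ ^ 2 ≤ C ^ 2 * ∑' k, ‖d k‖ ^ 2 := by
  haveI : Fact (0 < (1:ℝ)) := ⟨one_pos⟩
  let φ : ℕ → C(AddCircle (1:ℝ), ℂ) := fun k => fourier (k : ℤ)
  have key : ∀ c : ℕ → ℂ, (Summable fun k => ‖c k‖) → ∃ F : C(AddCircle (1:ℝ), ℂ),
      (∀ x : AddCircle (1:ℝ), F x = ∑' k, c k * ((AddCircle.toCircle x : Circle) : ℂ) ^ k) ∧
      HasSum (fun k => ‖c k‖ ^ 2)
        (‖ContinuousMap.toLp (E := ℂ) 2 (AddCircle.haarAddCircle (T := 1)) ℂ F‖ ^ 2) := by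
    intro c hc
    have hs : Summable fun k => c k • φ k := by
      apply Summable.of_norm
      refine hc.congr fun k => ?_
      rw [norm_smul, fourier_norm, mul_one]
    refine ⟨∑' k, c k • φ k, fun x => ?_, ?_⟩
    · rw [← ContinuousMap.tsum_apply hs]
      refine tsum_congr fun k => ?_
      simp [φ, fourier_apply, AddCircle.toCircle_nsmul]
    · have h1 := (ContinuousMap.toLp (E := ℂ) 2
        (AddCircle.haarAddCircle (T := 1)) ℂ).hasSum hs.hasSum
      refine aux_parseval_s8 (fun k : ℕ => fourierLp (T := 1) 2 (k : ℤ)) ?_ c _ ?_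
      · exact orthonormal_fourier.comp _ Nat.cast_injective
      · convert h1 using 2 with k
        simp [φ, fourierLp]
  obtain ⟨F, hF, hF2⟩ := key c hc
  obtain ⟨G, hG, hG2⟩ := key d hd
  refine ⟨hF2.summable, hG2.summable, ?_⟩
  rw [hF2.tsum_eq, hG2.tsum_eq, ← mul_pow]
  refine pow_le_pow_left₀ (norm_nonneg _) ?_ 2
  apply MeasureTheory.Lp.norm_le_mul_norm_of_ae_le_mul
  filter_upwards [ContinuousMap.coeFn_toLp (p := 2) (𝕜 := ℂ) (AddCircle.haarAddCircle (T := 1)) F,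
    ContinuousMap.coeFn_toLp (p := 2) (𝕜 := ℂ) (AddCircle.haarAddCircle (T := 1)) G] with x h1 h2
  rw [h1, h2, hF, hG]
  exact h _ (Circle.norm_coe _)

theorem aux_diff_s8 (a : ℕ → ℂ) (hs : ∀ w : ℂ, ‖w‖ < 1 → Summable (fun k => a k * w ^ k)) :
    DifferentiableOn ℂ (fun w => ∑' k, a k * w ^ k) (Metric.ball 0 1) := by
  intro z hz
  rw [mem_ball_zero_iff] at hz
  obtain ⟨ρ, h1, h2⟩ := exists_between hz
  have hρ : 0 ≤ ρ := (norm_nonneg z).trans h1.le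
  have hd : DifferentiableOn ℂ (fun w => ∑' k, a k * w ^ k) (Metric.ball 0 ρ) := by
    refine Complex.differentiableOn_tsum_of_summable_norm (u := fun k => ‖a k * (ρ : ℂ) ^ k‖)
      (hs _ (by simpa [abs_of_nonneg hρ] using h2)).norm (fun k => by fun_prop)
      Metric.isOpen_ball fun k w hw => ?_
    rw [mem_ball_zero_iff] at hw
    simp only [norm_mul, norm_pow, Complex.norm_real, Real.norm_eq_abs, abs_of_nonneg hρ]
    gcongr
  exact (hd.differentiableAt (Metric.isOpen_ball.mem_nhds
    (mem_ball_zero_iff.2 h1))).differentiableWithinAt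

theorem aux_alg (x y : ℂ) (hx : ‖x‖ < 1) (hy : ‖y‖ < 1) :
    0 < ‖1 - (starRingEnd ℂ) y * x‖ ∧ ‖x - y‖ ≤ ‖1 - (starRingEnd ℂ) y * x‖ := by
  constructor
  · rw [norm_pos_iff, sub_ne_zero]
    intro h
    have h' := congrArg norm h
    rw [norm_mul, RCLike.norm_conj, norm_one] at h'
    nlinarith [norm_nonneg x, norm_nonneg y]
  · refine le_of_sq_le_sq ?_ (norm_nonneg _)
    have hx' : ‖x‖ ^ 2 < 1 := by nlinarith [norm_nonneg x]
    have hy' : ‖y‖ ^ 2 < 1 := by nlinarith [norm_nonneg y]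
    have := mul_pos (sub_pos.2 hx') (sub_pos.2 hy')
    simp only [← Complex.normSq_eq_norm_sq, Complex.normSq_apply] at *
    simp at *
    nlinarith

open Filter Topology in
theorem aux_pick_s8 (g : ℂ → ℂ) (hg : DifferentiableOn ℂ g (Metric.ball 0 1))
    (hb : ∀ w : ℂ, ‖w‖ < 1 → ‖g w‖ ≤ 1) (w : ℂ) (hw : ‖w‖ < 1) :
    ‖g w - g 0‖ ≤ ‖w‖ * ‖1 - (starRingEnd ℂ) (g 0) * g w‖ := by
  have h1 : ∀ t : ℝ, 0 ≤ t → t < 1 → ‖t * g w - t * g 0‖ ≤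
      ‖w‖ * ‖1 - (starRingEnd ℂ) (t * g 0) * (t * g w)‖ := by
    intro t ht0 ht1
    have hlt : ∀ w : ℂ, ‖w‖ < 1 → ‖(t : ℂ) * g w‖ < 1 := by
      intro w hw
      rw [norm_mul, Complex.norm_real, Real.norm_eq_abs, abs_of_nonneg ht0]
      nlinarith [hb w hw, norm_nonneg (g w)]
    have h0 := hlt 0 (by simp)
    have := Complex.norm_le_norm_of_mapsTo_ball (R := 1) (z := w)
      (f := fun w => (t * g w - t * g 0) / (1 - (starRingEnd ℂ) (t * g 0) * (t * g w)))
      (by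
        apply DifferentiableOn.div
        · exact (hg.const_mul _).sub_const _
        · exact ((hg.const_mul _).const_mul _).const_sub _
        · intro z hz
          exact norm_pos_iff.1 (aux_alg _ _ (hlt z (mem_ball_zero_iff.1 hz)) h0).1)
      (by
        intro z hz
        obtain ⟨p1, p2⟩ := aux_alg _ _ (hlt z (mem_ball_zero_iff.1 hz)) h0
        rw [mem_closedBall_zero_iff, norm_div]
        exact (div_le_one p1).2 p2)
      (by simp) hw
    rwa [norm_div, div_le_iff₀ (aux_alg _ _ (hlt w hw) h0).1] at this
  have hcl : (1 : ℝ) ∈ closure (Set.Ico (0:ℝ) 1) := by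
    rw [closure_Ico (by norm_num)]; simp
  have h2 := ContinuousWithinAt.closure_le (f := fun t : ℝ => ‖(t:ℂ) * g w - t * g 0‖)
    (g := fun t : ℝ => ‖w‖ * ‖1 - (starRingEnd ℂ) (t * g 0) * (t * g w)‖) hcl
    (Continuous.continuousWithinAt (by fun_prop))
    (Continuous.continuousWithinAt (by
      have : Continuous (starRingEnd ℂ) := Complex.continuous_conj
      fun_prop)) (fun t ht => h1 t ht.1 ht.2)
  simpa using h2

theorem aux_key (a : ℕ → ℂ) (hs : ∀ w : ℂ, ‖w‖ < 1 → Summable (fun k => a k * w ^ k))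
    (hb : ∀ w : ℂ, ‖w‖ < 1 → ‖∑' k, a k * w ^ k‖ ≤ 1) (s : ℝ) (hs0 : 0 ≤ s) (hs1 : s < 1) (N : ℕ) :
    (∑ k ∈ Finset.range N, ‖a (k + 1)‖ ^ 2 * (s ^ 2) ^ (k + 1)) * (1 - ‖a 0‖ ^ 2 * s ^ 2) ≤
      s ^ 2 * (1 - ‖a 0‖ ^ 2) ^ 2 := by
  have hg0 : ∑' k, a k * (0:ℂ) ^ k = a 0 := by
    rw [tsum_eq_single 0 (fun k hk => by simp [hk])]; simp
  have ha0 : ‖a 0‖ ≤ 1 := by simpa [hg0] using hb 0 (by simp)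
  have hsn : ‖(s:ℂ)‖ = s := by simp [abs_of_nonneg hs0]
  have hsum : Summable fun k => ‖a k * (s:ℂ) ^ k‖ := (hs s (by rwa [hsn])).norm
  let c : ℕ → ℂ := fun k => if k = 0 then 0 else a k * (s:ℂ) ^ k
  let d : ℕ → ℂ := fun k => if k = 0 then ((‖a 0‖ ^ 2 - 1 : ℝ) : ℂ)
    else (starRingEnd ℂ) (a 0) * (a k * (s:ℂ) ^ k)
  have hc : Summable fun k => ‖c k‖ := by
    rw [← summable_nat_add_iff 1]
    exact ((summable_nat_add_iff 1).2 hsum).congr fun k => by simp [c]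
  have hd : Summable fun k => ‖d k‖ := by
    rw [← summable_nat_add_iff 1]
    exact (((summable_nat_add_iff 1).2 hsum).mul_left ‖a 0‖).congr fun k => by simp [d]
  have hsu : ∀ {c : ℕ → ℂ}, (Summable fun k => ‖c k‖) → ∀ u : ℂ, ‖u‖ = 1 →
      Summable fun k => c k * u ^ k := by
    intro c hc u hu
    apply Summable.of_norm
    exact hc.congr fun k => by simp [hu]
  obtain ⟨hc2, hd2, hle⟩ := aux_L2 c d hc hd s hs0 (by
    intro u hu
    have hw : ‖(s:ℂ) * u‖ < 1 := by rw [norm_mul, hsn, hu]; linarith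
    have hp := aux_pick_s8 _ (aux_diff_s8 a hs) hb _ hw
    simp only [hg0] at hp
    have e0 : ∑' k, a k * ((s:ℂ) * u) ^ k = a 0 + ∑' k, a (k+1) * ((s:ℂ) * u) ^ (k+1) := by
      rw [(hs _ hw).tsum_eq_zero_add]; simp
    have e1 : ∑' k, c k * u ^ k = ∑' k, a k * ((s:ℂ) * u) ^ k - a 0 := by
      rw [e0, (hsu hc u hu).tsum_eq_zero_add]
      simp [c, mul_pow, mul_assoc]
    have e2 : ∑' k, d k * u ^ k = -(1 - (starRingEnd ℂ) (a 0) * ∑' k, a k * ((s:ℂ) * u) ^ k) := by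
      rw [e0, (hsu hd u hu).tsum_eq_zero_add, mul_add, ← tsum_mul_left, mul_comm _ (a 0),
        Complex.mul_conj, Complex.normSq_eq_norm_sq]
      simp [d, mul_pow, mul_assoc]
      ring
    rw [e1, e2, norm_neg]
    rwa [norm_mul, hsn, hu, mul_one] at hp)
  have hM : Summable fun k => ‖a (k+1)‖ ^ 2 * (s^2) ^ (k+1) := by
    refine ((summable_nat_add_iff 1).2 hc2).congr fun k => ?_
    simp [c, mul_pow, abs_of_nonneg hs0, ← pow_mul, mul_comm]
  have e1 : ∑' k, ‖c k‖ ^ 2 = ∑' k, ‖a (k+1)‖ ^ 2 * (s^2) ^ (k+1) := by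
    rw [hc2.tsum_eq_zero_add]
    simp [c, mul_pow, abs_of_nonneg hs0, ← pow_mul, mul_comm]
  have e2 : ∑' k, ‖d k‖ ^ 2 = (1 - ‖a 0‖^2)^2 +
      ‖a 0‖^2 * ∑' k, ‖a (k+1)‖ ^ 2 * (s^2) ^ (k+1) := by
    rw [hd2.tsum_eq_zero_add, ← tsum_mul_left]
    congr 1
    · simp only [d, if_true, Complex.norm_real, Real.norm_eq_abs, sq_abs]; ring
    · refine tsum_congr fun k => ?_
      simp [d, mul_pow, abs_of_nonneg hs0, ← pow_mul, mul_comm]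
  rw [e1, e2] at hle
  have hfin := hM.sum_le_tsum (Finset.range N) (fun k _ => by positivity)
  have hpos : 0 ≤ 1 - ‖a 0‖^2 * s^2 := by
    have : ‖a 0‖^2 ≤ 1 := pow_le_one₀ (norm_nonneg _) ha0
    have : s^2 ≤ 1 := pow_le_one₀ hs0 hs1.le
    nlinarith [sq_nonneg s]
  have := mul_le_mul_of_nonneg_right hfin hpos
  nlinarith

theorem aux_key' (a : ℕ → ℂ) (hs : ∀ w : ℂ, ‖w‖ < 1 → Summable (fun k => a k * w ^ k))
    (hb : ∀ w : ℂ, ‖w‖ < 1 → ‖∑' k, a k * w ^ k‖ ≤ 1) (ρ : ℝ) (h0 : 0 ≤ ρ) (h1 : ρ ≤ 1) (N : ℕ) :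
    (∑ k ∈ Finset.range N, ‖a (k + 1)‖ ^ 2 * ρ ^ (k + 1)) * (1 - ‖a 0‖ ^ 2 * ρ) ≤
      ρ * (1 - ‖a 0‖ ^ 2) ^ 2 := by
  have hcl : ρ ∈ closure (Set.Ico (0:ℝ) 1) := by
    rw [closure_Ico (by norm_num)]; exact ⟨h0, h1⟩
  refine ContinuousWithinAt.closure_le
    (f := fun ρ : ℝ => (∑ k ∈ Finset.range N, ‖a (k + 1)‖ ^ 2 * ρ ^ (k + 1)) * (1 - ‖a 0‖ ^ 2 * ρ))
    (g := fun ρ : ℝ => ρ * (1 - ‖a 0‖ ^ 2) ^ 2) hcl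
    (Continuous.continuousWithinAt (by fun_prop))
    (Continuous.continuousWithinAt (by fun_prop)) (fun t ht => ?_)
  have := aux_key a hs hb (√t) (Real.sqrt_nonneg t)
    (by rw [Real.sqrt_lt' one_pos]; simpa using ht.2) N
  simpa only [Real.sq_sqrt ht.1] using this

theorem aux_main_s8 (a : ℕ → ℂ) (hs : ∀ w : ℂ, ‖w‖ < 1 → Summable (fun k => a k * w ^ k))
    (hb : ∀ w : ℂ, ‖w‖ < 1 → ‖∑' k, a k * w ^ k‖ ≤ 1) (R : ℝ) (h0 : 0 < R) (h1 : R < 1)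
    (hge : R ≤ ‖a 0‖) :
    ∑' k, ‖a k‖ * R ^ k ≤ ‖a 0‖ + R * (1 - ‖a 0‖ ^ 2) / (1 - R * ‖a 0‖) := by
  have hg0 : ∑' k, a k * (0:ℂ) ^ k = a 0 := by
    rw [tsum_eq_single 0 (fun k hk => by simp [hk])]; simp
  have ha1 : ‖a 0‖ ≤ 1 := by simpa [hg0] using hb 0 (by simp)
  have hsum : Summable fun k => ‖a k‖ * R ^ k := by
    refine (hs R (by simpa [abs_of_pos h0] using h1)).norm.congr fun k => ?_
    simp [abs_of_pos h0]
  rw [hsum.tsum_eq_zero_add]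
  simp only [pow_zero, mul_one]
  refine add_le_add le_rfl ?_
  refine Real.tsum_le_of_sum_range_le (fun k => by positivity) fun N => ?_
  have hk := aux_key' a hs hb (R / ‖a 0‖) (by positivity) (div_le_one_of_le₀ hge (norm_nonneg _)) N
  set A := ‖a 0‖ with hA
  have hA0 : 0 < A := h0.trans_le hge
  have hRA : R * A < 1 := by nlinarith
  have hcs := Finset.sum_sq_le_sum_mul_sum_of_sq_eq_mul (Finset.range N)
    (r := fun k => ‖a (k+1)‖ * R ^ (k+1)) (f := fun k => ‖a (k+1)‖ ^ 2 * (R / A) ^ (k+1))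
    (g := fun k => (R * A) ^ (k+1)) (fun k _ => by positivity) (fun k _ => by positivity)
    (fun k _ => by
      simp only [div_pow, mul_pow]
      field_simp)
  have hgeo : (∑ k ∈ Finset.range N, (R * A) ^ (k+1)) * (1 - R * A) ≤ R * A := by
    simp only [pow_succ, ← Finset.sum_mul]
    have := geom_sum_mul_neg (R * A) N
    have h3 : 0 ≤ (R * A) ^ N := by positivity
    have h4 : 0 < R * A := by positivity
    nlinarith
  have e1 : 1 - A ^ 2 * (R / A) = 1 - R * A := by field_simp
  rw [e1] at hk
  have hp : 0 < 1 - R * A := by linarith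
  rw [le_div_iff₀ hp]
  have hA2 : A ^ 2 ≤ 1 := pow_le_one₀ hA0.le ha1
  refine le_of_sq_le_sq ?_ (mul_nonneg h0.le (by linarith))
  have hmul := mul_le_mul hk hgeo (mul_nonneg (Finset.sum_nonneg fun k _ => by positivity) hp.le)
    (by positivity)
  calc _ = (∑ k ∈ Finset.range N, ‖a (k+1)‖ * R ^ (k+1)) ^ 2 * (1 - R * A) ^ 2 := by ring
    _ ≤ _ := mul_le_mul_of_nonneg_right hcs (sq_nonneg _)
    _ = _ := by ring
    _ ≤ _ := hmul
    _ = _ := by field_simp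


/-- Case `a ≥ r^p` of the proof of the Bohr inequality for `p`-symmetric functions:
if `f(z) = ∑_{k≥0} a_{pk+1} z^{pk+1}` with `|f| ≤ 1` on 𝔻, `a = |a_1|`, `0 < r < 1` and
`a ≥ r^p`, then `∑_{k≥0} |a_{pk+1}| r^{pk+1} ≤ r (a + r^p (1-a²)/(1 - r^p a))`. -/
theorem majorant_bound_case_one (p : ℕ) (hp : 0 < p) (f : ℂ → ℂ) (a : ℕ → ℂ)
    (hf : ∀ z ∈ Metric.ball (0 : ℂ) 1, HasSum (fun k : ℕ => a k * z ^ (p * k + 1)) (f z))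
    (hb : ∀ z ∈ Metric.ball (0 : ℂ) 1, ‖f z‖ ≤ 1)
    (r : ℝ) (hr0 : 0 < r) (hr1 : r < 1) (hge : r ^ p ≤ ‖a 0‖) :
    ∑' k : ℕ, ‖a k‖ * r ^ (p * k + 1) ≤
      r * (‖a 0‖ + r ^ p * (1 - ‖a 0‖ ^ 2) / (1 - r ^ p * ‖a 0‖)) := by
  have hroot : ∀ w : ℂ, ∃ z : ℂ, z ^ p = w := fun w => IsAlgClosed.exists_pow_nat_eq w hp
  have hzlt : ∀ z w : ℂ, z ^ p = w → ‖w‖ < 1 → ‖z‖ < 1 := by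
    intro z w h hw
    by_contra hz
    have := one_le_pow₀ (not_lt.1 hz) (n := p)
    rw [← norm_pow, h] at this
    linarith
  have hs : ∀ w : ℂ, ‖w‖ < 1 → Summable (fun k => a k * w ^ k) := by
    intro w hw
    rcases eq_or_ne w 0 with rfl | hw0
    · refine summable_of_ne_finset_zero (s := {0}) fun k hk => ?_
      simp at hk
      simp [hk]
    obtain ⟨z, hz⟩ := hroot w
    have hz0 : z ≠ 0 := by rintro rfl; exact hw0 (by rw [← hz, zero_pow hp.ne'])
    refine ((hf z (mem_ball_zero_iff.2 (hzlt z w hz hw))).summable.mul_right z⁻¹).congr fun k => ?_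
    rw [← hz, pow_succ, pow_mul]
    field_simp
  have hfg : ∀ z : ℂ, ‖z‖ < 1 → f z = z * ∑' k, a k * (z ^ p) ^ k := by
    intro z hz
    rw [← (hf z (mem_ball_zero_iff.2 hz)).tsum_eq, ← tsum_mul_left]
    refine tsum_congr fun k => ?_
    rw [pow_succ, pow_mul]; ring
  have hpw : Set.MapsTo (fun z : ℂ => z ^ p) (Metric.ball 0 1) (Metric.ball 0 1) := by
    intro z hz
    rw [mem_ball_zero_iff] at *
    simpa using pow_lt_one₀ (norm_nonneg z) hz hp.ne'
  have hfd : DifferentiableOn ℂ f (Metric.ball 0 1) := by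
    have h1 : DifferentiableOn ℂ (fun z => z * ∑' k, a k * (z ^ p) ^ k) (Metric.ball 0 1) :=
      differentiableOn_id.mul ((aux_diff_s8 a hs).comp (by fun_prop) hpw)
    exact h1.congr fun z hz => hfg z (mem_ball_zero_iff.1 hz)
  have hsch : ∀ z : ℂ, ‖z‖ < 1 → ‖f z‖ ≤ ‖z‖ := fun z hz =>
    Complex.norm_le_norm_of_mapsTo_ball hfd
      (fun z hz => mem_closedBall_zero_iff.2 (hb z hz)) (by rw [hfg 0 (by simp)]; simp) hz
  have hbne : ∀ w : ℂ, w ≠ 0 → ‖w‖ < 1 → ‖∑' k, a k * w ^ k‖ ≤ 1 := by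
    intro w hw0 hw
    obtain ⟨z, hz⟩ := hroot w
    have hz0 : z ≠ 0 := by rintro rfl; exact hw0 (by rw [← hz, zero_pow hp.ne'])
    have h1 := hsch z (hzlt z w hz hw)
    rw [hfg z (hzlt z w hz hw), norm_mul, hz] at h1
    have := norm_pos_iff.2 hz0
    nlinarith
  have hbg : ∀ w : ℂ, ‖w‖ < 1 → ‖∑' k, a k * w ^ k‖ ≤ 1 := by
    intro w hw
    rcases eq_or_ne w 0 with rfl | hw0
    · have hc : ContinuousAt (fun w : ℂ => ‖∑' k, a k * w ^ k‖) 0 :=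
        (((aux_diff_s8 a hs).differentiableAt (Metric.ball_mem_nhds _ one_pos)).continuousAt).norm
      refine le_of_tendsto (hc.tendsto.mono_left (nhdsWithin_le_nhds (s := {0}ᶜ))) ?_
      filter_upwards [self_mem_nhdsWithin,
        nhdsWithin_le_nhds (Metric.ball_mem_nhds (0:ℂ) one_pos)] with w h1 h2
      exact hbne w h1 (mem_ball_zero_iff.1 h2)
    · exact hbne w hw0 hw
  have hm := aux_main_s8 a hs hbg (r ^ p) (pow_pos hr0 p) (pow_lt_one₀ hr0.le hr1 hp.ne') hge
  have e : ∑' k : ℕ, ‖a k‖ * r ^ (p * k + 1) = r * ∑' k, ‖a k‖ * (r ^ p) ^ k := by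
    rw [← tsum_mul_left]
    refine tsum_congr fun k => ?_
    rw [pow_succ, pow_mul]; ring
  rw [e]
  exact mul_le_mul_of_nonneg_left hm hr0.le
end
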